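/- arXiv:2508.12578 — 3 statements merged into one kernel-verified Lean document; each statement's English description precedes it below -/
import Mathlib

section
/- Let r ≥ 2 be an integer. For all sufficiently large n, if G is a non-bipartite B_{r+1}-free simple graph on n vertices with e(G) = ⌊(n−1)²/4⌋ + 2r, then G is isomorphic to K^{r,r}_{⌊(n−1)/2⌋,⌈(n−1)/2⌉}. -/
open SimpleGraph Set

/-- `G` contains no book `B_{r+1}`, i.e. no two adjacent vertices of `G` have at least
`r + 1` common neighbours. -/
def BookFree {V : Type*} (r : ℕ) (G : SimpleGraph V) : Prop :=
  ∀ u v : V, G.Adj u v → ({w : V | G.Adj u w ∧ G.Adj v w}).ncard ≤ r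

/-- The graph `K^{r,r}_{a,b}` obtained from the complete bipartite graph `K_{a,b}` by adding a
new vertex (here `none`) adjacent to exactly the first `r` vertices in each of the two parts. -/
def KErr (a b r : ℕ) : SimpleGraph (Option (Fin a ⊕ Fin b)) :=
  SimpleGraph.fromRel (fun x y =>
    (∃ (i : Fin a) (j : Fin b), x = some (Sum.inl i) ∧ y = some (Sum.inr j)) ∨
    (∃ i : Fin a, x = none ∧ y = some (Sum.inl i) ∧ (i : ℕ) < r) ∨
    (∃ j : Fin b, x = none ∧ y = some (Sum.inr j) ∧ (j : ℕ) < r))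

namespace BookAux

open Classical in
/-- adjacency indicator -/
noncomputable def av {V : Type*} (G : SimpleGraph V) (x y : V) : ℤ := if G.Adj x y then 1 else 0

/-- same-side indicator -/
def sv {V : Type*} (c : V → Bool) (x y : V) : ℤ := if c x = c y then 1 else 0

section
variable {V : Type*} (G : SimpleGraph V) (c : V → Bool)

lemma av_cases (x y : V) : av G x y = 0 ∨ av G x y = 1 := by
  unfold av; split_ifs <;> simp
lemma sv_cases (x y : V) : sv c x y = 0 ∨ sv c x y = 1 := by
  unfold sv; split_ifs <;> simp
lemma av_comm (x y : V) : av G x y = av G y x := by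
  by_cases h : G.Adj x y
  · simp [av, h, h.symm]
  · have h2 : ¬ G.Adj y x := fun hh => h hh.symm
    simp [av, h, h2]
lemma sv_comm (x y : V) : sv c x y = sv c y x := by
  unfold sv; cases c x <;> cases c y <;> simp
lemma av_self (x : V) : av G x x = 0 := by simp [av]
lemma sv_self (x : V) : sv c x x = 1 := by simp [sv]
lemma av_one {x y : V} : av G x y = 1 ↔ G.Adj x y := by
  unfold av; split_ifs <;> simp_all
lemma sv_one {x y : V} : sv c x y = 1 ↔ c x = c y := by
  unfold sv; split_ifs <;> simp_all

variable [Fintype V]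

/-- internal degree -/
noncomputable def inn (u : V) : ℤ := ∑ w, av G u w * sv c u w
/-- cross degree -/
noncomputable def crs (u : V) : ℤ := ∑ w, av G u w * (1 - sv c u w)
/-- number of missing cross neighbours -/
noncomputable def mis (u : V) : ℤ := ∑ w, (1 - av G u w) * (1 - sv c u w)
/-- size of the other side -/
def oth (u : V) : ℤ := ∑ w, (1 - sv c u w)

lemma book {r : ℕ} (h : BookFree r G) {u v : V} (huv : G.Adj u v) :
    ∑ w, av G u w * av G v w ≤ r := by
  classical
  have := h u v huv
  have e : ∑ w, av G u w * av G v w = ((({w : V | G.Adj u w ∧ G.Adj v w}).ncard : ℕ) : ℤ) := by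
    rw [Set.ncard_eq_toFinset_card', Finset.card_eq_sum_ones, Set.toFinset_ofPred,
      Finset.sum_filter]
    push_cast
    refine Finset.sum_congr rfl fun w _ => ?_
    unfold av
    by_cases h1 : G.Adj u w <;> by_cases h2 : G.Adj v w <;> simp [h1, h2]
  rw [e]; exact_mod_cast this

lemma edges : ∑ x, ∑ y, av G x y = 2 * (G.edgeSet.ncard : ℤ) := by
  classical
  have h := G.sum_degrees_eq_twice_card_edges
  have e : G.edgeSet.ncard = G.edgeFinset.card := by
    rw [Set.ncard_eq_toFinset_card']; rfl
  rw [e]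
  have : ∀ x, ∑ y, av G x y = (G.degree x : ℤ) := by
    intro x
    unfold av
    rw [← G.card_neighborFinset_eq_degree, G.neighborFinset_eq_filter]
    simp
  simp_rw [this]
  exact_mod_cast h

lemma ident : ∑ u, inn G c u + ∑ u, oth c u = ∑ u, ∑ w, av G u w + ∑ u, mis G c u := by
  simp only [inn, oth, mis, ← Finset.sum_add_distrib]
  refine Finset.sum_congr rfl fun x _ => Finset.sum_congr rfl fun y _ => ?_
  ring

lemma inn_nonneg (u : V) : 0 ≤ inn G c u :=
  Finset.sum_nonneg fun w _ => by
    rcases av_cases G u w with h | h <;> rcases sv_cases c u w with h' | h' <;> simp [h, h']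
lemma mis_nonneg (u : V) : 0 ≤ mis G c u :=
  Finset.sum_nonneg fun w _ => by
    rcases av_cases G u w with h | h <;> rcases sv_cases c u w with h' | h' <;> simp [h, h']

lemma oth_total (u : V) : ∑ x, oth c x = 2 * oth c u * (Fintype.card V - oth c u) := by
  have h : ∀ x, oth c x = (Fintype.card V - oth c u) * (1 - sv c u x) + oth c u * sv c u x := by
    intro x
    rcases sv_cases c u x with h | h
    · rw [h]
      have hn : (Fintype.card V : ℤ) = ∑ w : V, (1 : ℤ) := by simp
      rw [hn]
      simp only [oth, ← Finset.sum_sub_distrib, sub_zero, mul_one, mul_zero, add_zero]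
      refine Finset.sum_congr rfl fun w _ => ?_
      revert h
      unfold sv
      cases c u <;> cases c x <;> cases c w <;> simp
    · have : c u = c x := (sv_one c).1 h
      rw [h]; simp [oth, sv, this]
  have h2 : ∑ x, sv c u x = Fintype.card V - oth c u := by
    simp [oth]
  rw [Finset.sum_congr rfl fun x _ => h x, Finset.sum_add_distrib, ← Finset.mul_sum,
    ← Finset.mul_sum, h2]
  change (_ : ℤ) * oth c u + _ = _
  ring

lemma step3 {r : ℕ} (h : BookFree r G) (u : V) :
    crs G c u * (inn G c u - r) ≤ ∑ x, mis G c x := by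
  rw [crs, Finset.sum_mul]
  refine Finset.sum_le_sum fun x _ => ?_
  rcases av_cases G u x with h1 | h1
  · simpa [h1] using mis_nonneg G c x
  rcases sv_cases c u x with h2 | h2
  swap
  · simpa [h2] using mis_nonneg G c x
  rw [h1, h2]
  have hb := book G h ((av_one G).1 h1)
  have : inn G c u ≤ mis G c x + ∑ w, av G u w * av G x w := by
    simp only [inn, mis, ← Finset.sum_add_distrib]
    refine Finset.sum_le_sum fun w _ => ?_
    have hs : sv c u w = 1 → sv c x w = 0 := by
      intro h3
      unfold sv at *
      grind
    rcases av_cases G u w with h | h <;> rcases av_cases G x w with h' | h' <;>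
    rcases sv_cases c u w with h'' | h'' <;> rcases sv_cases c x w with h3 | h3 <;>
    simp [h, h', h'', h3] <;> simp_all
  linarith

lemma step4 {r : ℕ} (h : BookFree r G) {u v : V} (huv : G.Adj u v) (hc : c u = c v) :
    oth c u ≤ mis G c u + mis G c v + r := by
  have hb := book G h huv
  have : oth c u ≤ mis G c u + mis G c v + ∑ w, av G u w * av G v w := by
    simp only [oth, mis, ← Finset.sum_add_distrib]
    refine Finset.sum_le_sum fun w _ => ?_
    have hs : sv c v w = sv c u w := by
      simp [sv, hc]
    rw [hs]
    rcases av_cases G u w with h | h <;> rcases av_cases G v w with h' | h' <;>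
    rcases sv_cases c u w with h'' | h'' <;> 
    simp [h, h', h'']
  linarith

lemma step4sum {r : ℕ} (h : BookFree r G) (L D : ℤ) (hL : ∀ u, L ≤ oth c u - r)
    (hD : ∀ u, inn G c u ≤ D) :
    (∑ u, inn G c u) * L ≤ 2 * D * ∑ u, mis G c u := by
  have e1 : ∑ u, ∑ v, av G u v * sv c u v * (mis G c u + mis G c v)
      = 2 * ∑ u, inn G c u * mis G c u := by
    simp only [mul_add, Finset.sum_add_distrib]
    rw [two_mul]
    congr 1
    · simp only [inn, Finset.sum_mul]
    · rw [Finset.sum_comm]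
      simp only [inn, Finset.sum_mul]
      refine Finset.sum_congr rfl fun x _ => Finset.sum_congr rfl fun y _ => ?_
      rw [av_comm G x y, sv_comm c x y]
  have e2 : (∑ u, inn G c u) * L ≤ ∑ u, ∑ v, av G u v * sv c u v * (mis G c u + mis G c v) := by
    simp only [inn, Finset.sum_mul]
    refine Finset.sum_le_sum fun x _ => Finset.sum_le_sum fun y _ => ?_
    rcases av_cases G x y with h1 | h1
    · simp [h1]
    rcases sv_cases c x y with h2 | h2
    · simp [h2]
    have := step4 G c h ((av_one G).1 h1) ((sv_one c).1 h2)
    have := hL x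
    rw [h1, h2]; linarith
  have e3 : ∑ u, inn G c u * mis G c u ≤ D * ∑ u, mis G c u := by
    rw [Finset.mul_sum]
    exact Finset.sum_le_sum fun x _ => mul_le_mul_of_nonneg_right (hD x) (mis_nonneg G c x)
  linarith

lemma qlem (Q : Finset V) : 2 * ∑ q ∈ Q, mis G c q ≤ ∑ u, mis G c u + (Q.card : ℤ) ^ 2 := by
  classical
  set f : V → V → ℤ := fun x y => (1 - av G x y) * (1 - sv c x y) with hf
  have f0 : ∀ x y, 0 ≤ f x y := fun x y => by
    rcases av_cases G x y with h | h <;> rcases sv_cases c x y with h' | h' <;> simp [hf, h, h']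
  have f1 : ∀ x y, f x y ≤ 1 := fun x y => by
    rcases av_cases G x y with h | h <;> rcases sv_cases c x y with h' | h' <;> simp [hf, h, h']
  have fc : ∀ x y, f x y = f y x := fun x y => by
    simp only [hf]; rw [av_comm G x y, sv_comm c x y]
  have a1 : ∑ u, mis G c u = ∑ u ∈ Q, mis G c u + ∑ u ∈ Qᶜ, mis G c u :=
    (Finset.sum_add_sum_compl Q _).symm
  have a2 : ∑ u ∈ Qᶜ, ∑ w ∈ Q, f u w ≤ ∑ u ∈ Qᶜ, mis G c u :=
    Finset.sum_le_sum fun x _ =>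
      Finset.sum_le_sum_of_subset_of_nonneg (Finset.subset_univ _) fun y _ _ => f0 x y
  have a3 : ∑ u ∈ Qᶜ, ∑ w ∈ Q, f u w = ∑ w ∈ Q, ∑ u ∈ Qᶜ, f w u := by
    rw [Finset.sum_comm]
    exact Finset.sum_congr rfl fun x _ => Finset.sum_congr rfl fun y _ => fc _ _
  have a4 : ∑ w ∈ Q, mis G c w = ∑ w ∈ Q, ∑ u ∈ Q, f w u + ∑ w ∈ Q, ∑ u ∈ Qᶜ, f w u := by
    rw [← Finset.sum_add_distrib]
    exact Finset.sum_congr rfl fun x _ => (Finset.sum_add_sum_compl Q _).symm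
  have a5 : ∑ w ∈ Q, ∑ u ∈ Q, f w u ≤ (Q.card : ℤ) ^ 2 := by
    calc _ ≤ ∑ w ∈ Q, ∑ u ∈ Q, (1 : ℤ) :=
          Finset.sum_le_sum fun x _ => Finset.sum_le_sum fun y _ => f1 x y
      _ = _ := by simp [sq]
  linarith

lemma flip [DecidableEq V] (u : V) :
    ∑ x, inn G (Function.update c u (!c u)) x
      = ∑ x, inn G c x + 2 * (crs G c u - inn G c u) := by
  set c' := Function.update c u (!c u) with hc'
  have key : ∀ x y, av G x y * sv c' x y = av G x y * sv c x y
      + (if x = u then av G u y * (1 - 2 * sv c u y) else 0)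
      + (if y = u then av G u x * (1 - 2 * sv c u x) else 0) := by
    intro x y
    by_cases hx : x = u <;> by_cases hy : y = u
    · subst hx; subst hy; simp [av_self]
    · subst hx
      have : sv c' x y = 1 - sv c x y := by
        simp only [sv, hc', Function.update_self, Function.update_of_ne hy]
        cases c x <;> cases c y <;> simp
      rw [this]; simp [hy]; ring
    · subst hy
      have : sv c' x y = 1 - sv c x y := by
        simp only [sv, hc', Function.update_self, Function.update_of_ne hx]
        cases c x <;> cases c y <;> simp
      rw [this, av_comm G x y, sv_comm c x y]; simp [hx]; ring
    · have : sv c' x y = sv c x y := by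
        simp only [sv, hc', Function.update_of_ne hx, Function.update_of_ne hy]
      simp [hx, hy, this]
  have e : ∑ y, av G u y * (1 - 2 * sv c u y) = crs G c u - inn G c u := by
    simp only [crs, inn, ← Finset.sum_sub_distrib]
    exact Finset.sum_congr rfl fun x _ => by ring
  simp only [inn, key, Finset.sum_add_distrib]
  rw [Finset.sum_comm (f := fun x y => if x = u then av G u y * (1 - 2 * sv c u y) else 0)]
  simp only [Finset.sum_ite_eq', Finset.mem_univ, if_true, e]
  simp only [inn]; ring

/-- Existence of a cut with few internal edges -/
lemma goodcut [Nonempty V] {r : ℕ} (h : BookFree r G) :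
    ∃ c : V → Bool, 2 * ∑ u, inn G c u ≤
      4 * r * Fintype.card V + (Fintype.card V : ℤ) ^ 2 - 2 * ∑ x, ∑ y, av G x y := by
  classical
  set d : V → ℤ := fun x => ∑ y, av G x y with hd
  obtain ⟨v, -, hv⟩ := Finset.exists_max_image Finset.univ d Finset.univ_nonempty
  refine ⟨fun x => decide (G.Adj v x), ?_⟩
  set χ : V → ℤ := fun x => av G v x with hχ
  have hs : ∀ x y, sv (fun x => decide (G.Adj v x)) x y = χ x * χ y + (1 - χ x) * (1 - χ y) := by
    intro x y
    simp only [sv, hχ, av]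
    by_cases h1 : G.Adj v x <;> by_cases h2 : G.Adj v y <;> simp [h1, h2]
  have χ0 : ∀ x, 0 ≤ χ x := fun x => by rcases av_cases G v x with h | h <;> simp [hχ, h]
  have χ1 : ∀ x, χ x ≤ 1 := fun x => by rcases av_cases G v x with h | h <;> simp [hχ, h]
  have b1 : ∑ x, ∑ y, av G x y * (χ x * χ y) ≤ r * Fintype.card V := by
    calc _ ≤ ∑ x : V, (r : ℤ) := Finset.sum_le_sum fun x _ => ?_
      _ = _ := by simp [mul_comm]
    rcases av_cases G v x with h1 | h1
    · simp [hχ, h1]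
    · have := book G h ((av_one G).1 h1)
      simp only [hχ, h1, one_mul]
      refine le_trans (le_of_eq ?_) this
      exact Finset.sum_congr rfl fun y _ => mul_comm _ _
  have b2 : ∑ x, (1 - χ x) * d x ≤ (Fintype.card V - d v) * d v := by
    have : (Fintype.card V - d v) = ∑ x, (1 - χ x) := by simp [hd, hχ]
    rw [this, Finset.sum_mul]
    exact Finset.sum_le_sum fun x _ =>
      mul_le_mul_of_nonneg_left (hv x (Finset.mem_univ _)) (by linarith [χ1 x])
  have b3 : ∑ x, ∑ y, av G x y * (1 - χ x) = ∑ x, (1 - χ x) * d x := by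
    simp only [hd, Finset.mul_sum]
    exact Finset.sum_congr rfl fun x _ => Finset.sum_congr rfl fun y _ => mul_comm _ _
  have b4 : ∑ x, ∑ y, av G x y * (1 - χ y) = ∑ x, (1 - χ x) * d x := by
    rw [← b3, Finset.sum_comm]
    exact Finset.sum_congr rfl fun x _ => Finset.sum_congr rfl fun y _ => by rw [av_comm]
  have b5 : ∑ u, inn G (fun x => decide (G.Adj v x)) u =
      2 * ∑ x, ∑ y, av G x y * (χ x * χ y) + ∑ x, ∑ y, av G x y * (1 - χ x)
       + ∑ x, ∑ y, av G x y * (1 - χ y) - ∑ x, ∑ y, av G x y := by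
    simp only [inn, hs, Finset.mul_sum, ← Finset.sum_add_distrib, ← Finset.sum_sub_distrib]
    exact Finset.sum_congr rfl fun x _ => Finset.sum_congr rfl fun y _ => by ring
  rw [b3, b4] at b5
  nlinarith [sq_nonneg ((Fintype.card V : ℤ) - 2 * d v)]

lemma mincut [Nonempty V] {r : ℕ} (h : BookFree r G) :
    ∃ c : V → Bool, 2 * ∑ u, inn G c u ≤
      4 * r * Fintype.card V + (Fintype.card V : ℤ) ^ 2 - 2 * ∑ x, ∑ y, av G x y
      ∧ ∀ u, inn G c u ≤ crs G c u := by
  classical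
  obtain ⟨c0, h0⟩ := goodcut G h
  obtain ⟨c, -, hc⟩ := Finset.exists_min_image Finset.univ (fun c : V → Bool => ∑ u, inn G c u)
    ⟨c0, Finset.mem_univ _⟩
  refine ⟨c, by linarith [hc c0 (Finset.mem_univ _)], fun u => ?_⟩
  have := hc _ (Finset.mem_univ (Function.update c u (!c u)))
  rw [flip] at this
  linarith

/-- Numeric core -/
lemma numeric (R N : ℤ) (hR : 2 ≤ R) (hN : 100000 * (R + 1) ^ 3 ≤ N)
    {r : ℕ} (hr : (r : ℤ) = R) (h : BookFree r G) (hV : (Fintype.card V : ℤ) = N)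
    (hE : (N - 1) ^ 2 ≤ 2 * ∑ x, ∑ y, av G x y) :
    ∃ c : V → Bool, 10 * ∑ u, mis G c u ≤ 11 * N ∧ ∀ u, 44 * N ≤ 100 * (oth c u - R) := by
  have hR3 : (R + 1) ≤ (R + 1) ^ 2 := by nlinarith
  have hR4 : (R + 1) ^ 2 ≤ (R + 1) ^ 3 := by nlinarith
  have hNpos : 0 < N := by nlinarith
  have : Nonempty V := by
    by_contra hh
    rw [not_nonempty_iff] at hh
    simp at hV
    omega
  obtain ⟨c, h1, h2⟩ := mincut G h
  rw [hV, hr] at h1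
  have hid := ident G c
  have hM0 : 0 ≤ ∑ u, mis G c u := Finset.sum_nonneg fun u _ => mis_nonneg G c u
  have hH0 : 0 ≤ ∑ u, inn G c u := Finset.sum_nonneg fun u _ => inn_nonneg G c u
  have ho := oth_total c
  have hs3 := step3 G c h
  have hs4 := step4sum G c h
  rw [hr] at hs3 hs4
  rw [hV] at ho
  set M := ∑ u, mis G c u
  set H := ∑ u, inn G c u
  set O := ∑ u, oth c u
  set E := ∑ x, ∑ y, av G x y
  have hH : H ≤ (2 * R + 1) * N := by nlinarith
  have hO2 : ∀ u, 2 * O = N ^ 2 - (N - 2 * oth c u) ^ 2 := fun u => by rw [ho u]; ring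
  have hMH : M ≤ H + N := by
    obtain ⟨u⟩ := this
    nlinarith [hO2 u, sq_nonneg (N - 2 * oth c u)]
  have hM : M ≤ (2 * R + 2) * N := by linarith
  have hoth : ∀ u, 44 * N ≤ 100 * (oth c u - R) := by
    intro u
    have a1 : (N - 2 * oth c u) ^ 2 ≤ (4 * R + 4) * N := by nlinarith [hO2 u]
    have a2 : 10 * (N - 2 * oth c u) ≤ N := by
      by_contra hh
      push Not at hh
      have : N ^ 2 ≤ 100 * (N - 2 * oth c u) ^ 2 := by nlinarith
      nlinarith
    nlinarith
  refine ⟨c, ?_, hoth⟩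
  set K := 100 * (R + 1) with hK
  have hinn : ∀ u, K * inn G c u ≤ N := by
    intro u
    by_contra hh
    push Not at hh
    have i0 := inn_nonneg G c u
    have hKR : K * R + K ^ 2 * (2 * R + 2) < N := by
      rw [hK]; nlinarith
    have hrr : 0 ≤ K * inn G c u - K * R := by nlinarith
    have hrr' : 0 ≤ inn G c u - R := by
      by_contra h'
      push Not at h'
      nlinarith
    have i1 : inn G c u * (inn G c u - R) ≤ (2 * R + 2) * N := by
      nlinarith [hs3 u, h2 u]
    have i2 : N * (N - K * R) ≤ (K * inn G c u) * (K * inn G c u - K * R) := by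
      apply mul_le_mul hh.le (by linarith) (by nlinarith) (by linarith)
    have i3 : (K * inn G c u) * (K * inn G c u - K * R) ≤ K ^ 2 * ((2 * R + 2) * N) := by
      have := mul_le_mul_of_nonneg_left i1 (sq_nonneg K)
      linarith
    nlinarith
  have key : ∃ D : ℤ, (∀ u, inn G c u ≤ D) ∧ K * D ≤ N := by
    obtain ⟨u, -, hu⟩ := Finset.exists_max_image Finset.univ (inn G c) Finset.univ_nonempty
    exact ⟨_, fun v => hu v (Finset.mem_univ _), hinn u⟩
  have keyL : ∃ L : ℤ, (∀ u, L ≤ oth c u - R) ∧ 44 * N ≤ 100 * L := by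
    obtain ⟨u, -, hu⟩ := Finset.exists_min_image Finset.univ (oth c) Finset.univ_nonempty
    exact ⟨oth c u - R, fun v => by linarith [hu v (Finset.mem_univ _)], hoth u⟩
  obtain ⟨D, hD, hKD⟩ := key
  obtain ⟨L, hL, hNL⟩ := keyL
  have h5 := hs4 L D hL hD
  have h6 : K * (H * (44 * N)) ≤ 200 * (N * ((2 * R + 2) * N)) := by
    have t1 : H * (44 * N) ≤ H * (100 * L) := mul_le_mul_of_nonneg_left hNL hH0
    have t2 : K * D * M ≤ N * ((2 * R + 2) * N) := by
      apply mul_le_mul hKD hM hM0 hNpos.le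
    have hK0 : 0 ≤ K := by rw [hK]; linarith
    have t3 := mul_le_mul_of_nonneg_left t1 hK0
    have t4 := mul_le_mul_of_nonneg_left h5 hK0
    nlinarith
  have h7 : 10 * H ≤ N := by
    by_contra hh
    push Not at hh
    have t : 0 < (R + 1) * N := by positivity
    have := mul_lt_mul_of_pos_left hh t
    rw [hK] at h6
    nlinarith
  linarith

end
end BookAux

namespace BookAux

section
variable {V : Type*} [Fintype V] (G : SimpleGraph V) (c : V → Bool)

/-- There is a vertex whose removal leaves a bipartite graph. -/
lemma apex (R N : ℤ) (hR : 2 ≤ R) (hN : 100000 * (R + 1) ^ 3 ≤ N)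
    {r : ℕ} (hr : (r : ℤ) = R) (h : BookFree r G) (hV : (Fintype.card V : ℤ) = N)
    (hE : (N - 1) ^ 2 ≤ 2 * ∑ x, ∑ y, av G x y) (hcol : ¬ G.Colorable 2) :
    ∃ (c : V → Bool) (u : V), ∀ x y, x ≠ u → y ≠ u → G.Adj x y → c x ≠ c y := by
  classical
  obtain ⟨c, hM, hO⟩ := numeric G R N hR hN hr h hV hE
  have hR3 : (R + 1) ≤ (R + 1) ^ 2 := by nlinarith
  have hR4 : (R + 1) ^ 2 ≤ (R + 1) ^ 3 := by nlinarith
  have hNpos : 100000 < N := by nlinarith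
  have e4 : ∀ u v, G.Adj u v → c u = c v → 44 * N ≤ 100 * (mis G c u + mis G c v) := by
    intro u v huv hc
    have := step4 G c h huv hc
    have := hO u
    linarith
  have disj : ∀ u v x y, G.Adj u v → c u = c v → G.Adj x y → c x = c y →
      u ≠ x → u ≠ y → v ≠ x → v ≠ y → False := by
    intro u v x y h1 h2 h3 h4 n1 n2 n3 n4
    have n5 := h1.ne
    have n6 := h3.ne
    have q := qlem G c {u, v, x, y}
    have hcard : ({u, v, x, y} : Finset V).card = 4 := by
      simp [Finset.card_insert_of_notMem, *]
    rw [hcard, Finset.sum_insert (by simp [*]), Finset.sum_insert (by simp [*]),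
      Finset.sum_insert (by simp [*]), Finset.sum_singleton] at q
    have := e4 u v h1 h2
    have := e4 x y h3 h4
    push_cast at q
    linarith
  have tri : ∀ u v w, G.Adj u v → c u = c v → G.Adj v w → c v = c w → G.Adj u w → False := by
    intro u v w h1 h2 h3 h4 h5
    have n1 := h1.ne
    have n2 := h3.ne
    have n3 := h5.ne
    have q := qlem G c {u, v, w}
    have hcard : ({u, v, w} : Finset V).card = 3 := by
      simp [Finset.card_insert_of_notMem, *]
    rw [hcard, Finset.sum_insert (by simp [*]), Finset.sum_insert (by simp [*]),
      Finset.sum_singleton] at q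
    have := e4 u v h1 h2
    have := e4 v w h3 h4
    have := e4 u w h5 (h2.trans h4)
    push_cast at q
    linarith
  have ex : ∃ u v, G.Adj u v ∧ c u = c v := by
    by_contra hh
    push Not at hh
    apply hcol
    exact (SimpleGraph.Coloring.colorable (G.recolorOfEquiv finTwoEquiv.symm
      (SimpleGraph.Coloring.mk c fun {a b} hab => hh a b hab)))
  obtain ⟨u, v, huv, hc⟩ := ex
  by_contra hh
  push Not at hh
  obtain ⟨x, y, xu, yu, hxy, cxy⟩ := hh c u
  obtain ⟨x', y', xv, yv, hxy', cxy'⟩ := hh c v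
  have A : ∃ w, w ≠ u ∧ G.Adj v w ∧ c v = c w := by
    by_cases h1 : v = x
    · exact ⟨y, yu, h1 ▸ hxy, h1 ▸ cxy⟩
    by_cases h2 : v = y
    · exact ⟨x, xu, h2 ▸ hxy.symm, h2 ▸ cxy.symm⟩
    exact (disj u v x y huv hc hxy cxy xu.symm yu.symm h1 h2).elim
  have B : ∃ w, w ≠ v ∧ G.Adj u w ∧ c u = c w := by
    by_cases h1 : u = x'
    · exact ⟨y', yv, h1 ▸ hxy', h1 ▸ cxy'⟩
    by_cases h2 : u = y'
    · exact ⟨x', xv, h2 ▸ hxy'.symm, h2 ▸ cxy'.symm⟩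
    exact (disj u v x' y' huv hc hxy' cxy' h1 h2 xv.symm yv.symm).elim
  obtain ⟨w, wu, vw, cvw⟩ := A
  obtain ⟨z, zv, uz, cuz⟩ := B
  by_cases hwz : w = z
  · subst hwz
    exact tri u v w huv hc vw cvw uz
  · exact disj v w u z vw cvw uz cuz huv.ne.symm zv.symm wu hwz

/-- indicator of side `b` minus the apex -/
noncomputable def sd [DecidableEq V] (u : V) (b : Bool) (x : V) : ℤ :=
  if x ≠ u ∧ c x = b then 1 else 0

lemma sd_cases [DecidableEq V] (u : V) (b : Bool) (x : V) : sd c u b x = 0 ∨ sd c u b x = 1 := by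
  unfold sd; split_ifs <;> simp

lemma sd_sum [DecidableEq V] (u : V) (b : Bool) (x : V) :
    sd c u b x + sd c u (!b) x + (if x = u then 1 else 0) = 1 := by
  unfold sd
  by_cases h : x = u
  · simp [h]
  · cases b <;> cases hc : c x <;> simp [h]

lemma missST [DecidableEq V] {r : ℕ} (h : BookFree r G) (u : V) (b : Bool) :
    (∑ y, av G u y * sd c u (!b) y) * ((∑ x, av G u x * sd c u b x) - r)
      ≤ ∑ y, ∑ x, (1 - av G y x) * (sd c u (!b) y * sd c u b x) := by
  rw [Finset.sum_mul]
  refine Finset.sum_le_sum fun y _ => ?_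
  have nn : 0 ≤ ∑ x, (1 - av G y x) * (sd c u (!b) y * sd c u b x) :=
    Finset.sum_nonneg fun x _ => by
      rcases av_cases G y x with h1 | h1 <;> rcases sd_cases c u b x with h2 | h2 <;>
      rcases sd_cases c u (!b) y with h3 | h3 <;> simp [h1, h2, h3]
  rcases av_cases G u y with h1 | h1
  · simpa [h1] using nn
  rcases sd_cases c u (!b) y with h2 | h2
  · simp [h2]
  rw [h1, h2]
  have hb := book G h ((av_one G).1 h1)
  have : ∑ x, av G u x * sd c u b x ≤
      ∑ x, (1 - av G y x) * (1 * sd c u b x) + ∑ x, av G u x * av G y x := by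
    rw [← Finset.sum_add_distrib]
    refine Finset.sum_le_sum fun x _ => ?_
    rcases av_cases G y x with h1 | h1 <;> rcases sd_cases c u b x with h2 | h2 <;>
      rcases av_cases G u x with h3 | h3 <;> simp [h1, h2, h3]
  linarith

lemma arith (r s t m p q e F n : ℤ) (hr : 2 ≤ r) (hs : 1 ≤ s) (ht : 1 ≤ t) (hm : 0 ≤ m)
    (h1 : t * (s - r) ≤ m) (h2 : s * (t - r) ≤ m) (he : e = s + t + p * q - m)
    (hF : p * q ≤ F) (heF : e = F + 2 * r) : s = r ∧ t = r ∧ m = 0 ∧ p * q = F := by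
  have hkey : m + 2 * r ≤ s + t := by linarith
  have hsr : s ≤ r := by
    by_contra hh
    push Not at hh
    by_cases htr : t ≤ r
    · nlinarith [mul_nonneg (by linarith : 0 ≤ t - 1) (by linarith : 0 ≤ s - r - 1)]
    · push Not at htr
      nlinarith [mul_nonneg (by linarith : 0 ≤ t - r - 1) (by linarith : 0 ≤ s - r - 1)]
  have htr : t ≤ r := by
    by_contra hh
    push Not at hh
    nlinarith [mul_nonneg (by linarith : 0 ≤ s - 1) (by linarith : 0 ≤ t - r - 1)]
  refine ⟨by linarith, by linarith, by linarith, by linarith⟩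

lemma apex_struct [DecidableEq V] {r : ℕ} (hr : 2 ≤ r) (h : BookFree r G)
    (hcol : ¬ G.Colorable 2) (u : V)
    (hu : ∀ x y, x ≠ u → y ≠ u → G.Adj x y → c x ≠ c y)
    (hE : G.edgeSet.ncard = (Fintype.card V - 1) ^ 2 / 4 + 2 * r) :
    ∑ x, av G u x * sd c u true x = r ∧ ∑ x, av G u x * sd c u false x = r ∧
    (∀ x y, x ≠ u → y ≠ u → c x ≠ c y → G.Adj x y) ∧
    (∑ x, sd c u true x) * (∑ x, sd c u false x) = (((Fintype.card V - 1) ^ 2 / 4 : ℕ) : ℤ) ∧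
    (∑ x, sd c u true x) + (∑ x, sd c u false x) = Fintype.card V - 1 := by
  have hpos : 0 < Fintype.card V := Fintype.card_pos_iff.2 ⟨u⟩
  -- both degrees positive
  have pos : ∀ b, 1 ≤ ∑ x, av G u x * sd c u b x := by
    intro b
    by_contra hh
    have nn : ∀ x ∈ Finset.univ, 0 ≤ av G u x * sd c u b x := fun x _ => by
      rcases av_cases G u x with h1 | h1 <;> rcases sd_cases c u b x with h2 | h2 <;>
      simp [h1, h2]
    have z : ∑ x, av G u x * sd c u b x = 0 := by
      have := Finset.sum_nonneg nn
      linarith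
    rw [Finset.sum_eq_zero_iff_of_nonneg nn] at z
    have z' : ∀ x, G.Adj u x → c x ≠ b := by
      intro x hx hc
      have := z x (Finset.mem_univ _)
      rw [(av_one G).2 hx] at this
      simp [sd, hx.ne', hc] at this
    apply hcol
    refine (SimpleGraph.Coloring.colorable (G.recolorOfEquiv finTwoEquiv.symm
      (SimpleGraph.Coloring.mk (Function.update c u b) fun {x y} hxy => ?_)))
    by_cases hx : x = u
    · subst hx
      rw [Function.update_self, Function.update_of_ne hxy.ne']
      exact (z' y hxy).symm
    by_cases hy : y = u
    · subst hy
      rw [Function.update_self, Function.update_of_ne hx]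
      exact z' x hxy.symm
    rw [Function.update_of_ne hx, Function.update_of_ne hy]
    exact hu x y hx hy hxy
  have hm1 := missST G c h u true
  have hm2 := missST G c h u false
  simp only [Bool.not_true, Bool.not_false] at hm1 hm2
  have hcomm : ∑ y, ∑ x, (1 - av G y x) * (sd c u true y * sd c u false x) =
      ∑ y, ∑ x, (1 - av G y x) * (sd c u false y * sd c u true x) := by
    rw [Finset.sum_comm]
    exact Finset.sum_congr rfl fun x _ => Finset.sum_congr rfl fun y _ => by
      rw [av_comm]; ring
  have nn : ∀ x y, 0 ≤ (1 - av G x y) * (sd c u true x * sd c u false y) := fun x y => by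
    rcases av_cases G x y with h1 | h1 <;> rcases sd_cases c u true x with h2 | h2 <;>
      rcases sd_cases c u false y with h3 | h3 <;> simp [h1, h2, h3]
  have hm0 : 0 ≤ ∑ y, ∑ x, (1 - av G y x) * (sd c u true y * sd c u false x) :=
    Finset.sum_nonneg fun y _ => Finset.sum_nonneg fun x _ => nn y x
  rw [← hcomm] at hm1
  have hpq : (∑ x, sd c u true x) + (∑ x, sd c u false x) = Fintype.card V - 1 := by
    have : ∑ x, (sd c u true x + sd c u (!true) x + (if x = u then 1 else 0)) = ∑ x : V, (1 : ℤ) :=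
      Finset.sum_congr rfl fun x _ => sd_sum c u true x
    simp only [Finset.sum_add_distrib, Finset.sum_ite_eq', Finset.mem_univ, if_true] at this
    simp at this
    linarith
  have hF : (∑ x, sd c u true x) * (∑ x, sd c u false x)
      ≤ (((Fintype.card V - 1) ^ 2 / 4 : ℕ) : ℤ) := by
    push_cast [Nat.cast_sub (show 1 ≤ Fintype.card V from hpos)]
    rw [Int.le_ediv_iff_mul_le (by norm_num), ← hpq]
    nlinarith [sq_nonneg ((∑ x, sd c u true x) - (∑ x, sd c u false x))]
  -- edges
  have hpt : ∀ x y, av G x y = av G x y * (sd c u true x * sd c u false y)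
      + av G y x * (sd c u true y * sd c u false x)
      + (if x = u then av G u y else 0) + (if y = u then av G u x else 0) := by
    intro x y
    rw [av_comm G y x]
    by_cases hx : x = u <;> by_cases hy : y = u
    · subst hx; subst hy; simp [av_self]
    · subst hx; simp [hy, sd]
    · subst hy; simp [hx, sd, av_comm G x y]
    · rcases av_cases G x y with h1 | h1
      · simp [h1, hx, hy]
      · have := hu x y hx hy ((av_one G).1 h1)
        simp only [h1, hx, hy, sd, ne_eq, not_false_eq_true, true_and, if_false]
        revert this
        cases c x <;> cases c y <;> simp
  have hdeg : ∑ y, av G u y = ∑ x, av G u x * sd c u true x + ∑ x, av G u x * sd c u false x := by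
    rw [← Finset.sum_add_distrib]
    refine Finset.sum_congr rfl fun x _ => ?_
    have := sd_sum c u true x
    by_cases hx : x = u
    · subst hx; simp [av_self]
    · simp only [hx, if_false, Bool.not_true] at this
      rw [← mul_add]
      rw [show sd c u true x + sd c u false x = 1 by linarith, mul_one]
  have hed := edges G
  have hed2 : ∑ x, ∑ y, av G x y = 2 * ∑ x, ∑ y, av G x y * (sd c u true x * sd c u false y)
      + 2 * ∑ y, av G u y := by
    conv_lhs => rw [Finset.sum_congr rfl fun x _ => Finset.sum_congr rfl fun y _ => hpt x y]
    simp only [Finset.sum_add_distrib]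
    rw [Finset.sum_comm (f := fun x y => av G y x * (sd c u true y * sd c u false x)),
      Finset.sum_comm (f := fun x y => if x = u then av G u y else 0)]
    simp only [Finset.sum_ite_eq', Finset.mem_univ, if_true]
    ring
  have hm : ∑ y, ∑ x, (1 - av G y x) * (sd c u true y * sd c u false x) =
      (∑ x, sd c u true x) * (∑ x, sd c u false x)
       - ∑ x, ∑ y, av G x y * (sd c u true x * sd c u false y) := by
    rw [Finset.sum_mul_sum]
    simp only [← Finset.sum_sub_distrib]
    exact Finset.sum_congr rfl fun x _ => Finset.sum_congr rfl fun y _ => by ring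
  obtain ⟨a1, a2, a3, a4⟩ := arith (r : ℤ) _ _ _ _ _ (G.edgeSet.ncard : ℤ) _ 0
    (by exact_mod_cast hr) (pos true) (pos false) hm0 hm1 hm2 (by linarith) hF
    (by rw [hE]; push_cast; ring)
  refine ⟨a1, a2, ?_, a4, hpq⟩
  have key : ∀ x y, x ≠ u → y ≠ u → c x = true → c y = false → G.Adj x y := by
    intro x y hx hy cx cy
    rw [Finset.sum_eq_zero_iff_of_nonneg
      (fun x _ => Finset.sum_nonneg fun y _ => nn x y)] at a3
    have := a3 x (Finset.mem_univ _)
    rw [Finset.sum_eq_zero_iff_of_nonneg (fun y _ => nn x y)] at this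
    have := this y (Finset.mem_univ _)
    rw [← av_one G]
    simp [sd, hx, hy, cx, cy] at this
    linarith
  intro x y hx hy hc
  cases cx : c x <;> cases cy : c y
  · simp [cx, cy] at hc
  · exact (key y x hy hx cy cx).symm
  · exact key x y hx hy cx cy
  · simp [cx, cy] at hc

/-- labelling a finite set with a marked subset of size `r` -/
lemma label (A : Finset V) (S : V → Prop) [DecidablePred S] (a r : ℕ) (hA : A.card = a)
    (hS : (A.filter S).card = r) :
    ∃ f : Fin a → V, Function.Injective f ∧ (∀ i, f i ∈ A) ∧ ∀ i, S (f i) ↔ (i : ℕ) < r := by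
  classical
  subst hA
  have hle : r ≤ A.card := hS ▸ Finset.card_filter_le _ _
  let e0 : Fin A.card ≃ A := A.equivFin.symm
  have hc : Fintype.card {i : Fin A.card // (i : ℕ) < r}
      = Fintype.card {i : Fin A.card // S (e0 i)} := by
    have h1 : Fintype.card {i : Fin A.card // (i : ℕ) < r} = r := by
      have e : {i : Fin A.card // (i : ℕ) < r} ≃ Fin r :=
        { toFun := fun i => ⟨i.1, i.2⟩
          invFun := fun i => ⟨⟨i.1, i.2.trans_le hle⟩, i.2⟩
          left_inv := fun i => rfl
          right_inv := fun i => rfl }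
      rw [Fintype.card_congr e, Fintype.card_fin]
    have h2 : Fintype.card {i : Fin A.card // S (e0 i)} = r := by
      refine Eq.trans ?_ ((Fintype.card_coe (A.filter S)).trans hS)
      refine Fintype.card_congr
        { toFun := fun i => ⟨e0 i.1, Finset.mem_filter.2 ⟨(e0 i.1).2, i.2⟩⟩
          invFun := fun x => ⟨e0.symm ⟨x.1, (Finset.mem_filter.1 x.2).1⟩, by
            simpa using (Finset.mem_filter.1 x.2).2⟩
          left_inv := fun i => by simp
          right_inv := fun i => by simp }
    rw [h1, h2]
  let e1 := Fintype.equivOfCardEq hc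
  let p := e1.extendSubtype
  refine ⟨fun i => e0 (p i), fun i j hij => p.injective (e0.injective (Subtype.ext hij)),
    fun i => (e0 (p i)).2, fun i => ?_⟩
  by_cases hi : (i : ℕ) < r
  · have := e1.extendSubtype_mem i hi
    exact ⟨fun _ => hi, fun _ => this⟩
  · have := e1.extendSubtype_not_mem i hi
    exact ⟨fun h => (this h).elim, fun h => (hi h).elim⟩

lemma build [DecidableEq V] {r : ℕ} (u : V) (a b : ℕ)
    (hu : ∀ x y, x ≠ u → y ≠ u → G.Adj x y → c x ≠ c y)
    (hu' : ∀ x y, x ≠ u → y ≠ u → c x ≠ c y → G.Adj x y)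
    (hs : ∑ x, av G u x * sd c u true x = r) (ht : ∑ x, av G u x * sd c u false x = r)
    (hp : ∑ x, sd c u true x = a) (hq : ∑ x, sd c u false x = b)
    (hn : Fintype.card V = a + b + 1) :
    Nonempty (G ≃g KErr a b r) := by
  classical
  have cardA : ∀ d, ((Finset.univ.filter fun x => x ≠ u ∧ c x = d).card : ℤ) = ∑ x, sd c u d x := by
    intro d; simp [sd]
  have cardS : ∀ d, (((Finset.univ.filter fun x => x ≠ u ∧ c x = d).filter (G.Adj u)).card : ℤ)
      = ∑ x, av G u x * sd c u d x := by
    intro d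
    rw [Finset.filter_filter, Finset.card_filter]
    push_cast
    refine Finset.sum_congr rfl fun x _ => ?_
    by_cases h1 : G.Adj u x <;> by_cases h2 : x ≠ u ∧ c x = d <;> simp [av, sd, h1, h2]
  obtain ⟨f, fi, fA, fS⟩ := label _ (G.Adj u) a r
    (by exact_mod_cast (cardA true).trans hp) (by exact_mod_cast (cardS true).trans hs)
  obtain ⟨g, gi, gA, gS⟩ := label _ (G.Adj u) b r
    (by exact_mod_cast (cardA false).trans hq) (by exact_mod_cast (cardS false).trans ht)
  simp only [Finset.mem_filter, Finset.mem_univ, true_and] at fA gA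
  let F : Option (Fin a ⊕ Fin b) → V := fun o => match o with
    | none => u
    | some (Sum.inl i) => f i
    | some (Sum.inr j) => g j
  have Finj : Function.Injective F := by
    rintro (_ | i | i) (_ | j | j) hij
    · rfl
    · exact ((fA j).1 hij.symm).elim
    · exact ((gA j).1 hij.symm).elim
    · exact ((fA i).1 hij).elim
    · rw [fi hij]
    · have h1 := (fA i).2
      have h2 := (gA j).2
      have h3 : f i = g j := hij
      rw [h3, h2] at h1; simp at h1
    · exact ((gA i).1 hij).elim
    · have h1 := (fA j).2
      have h2 := (gA i).2
      have h3 : g i = f j := hij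
      rw [← h3, h2] at h1; simp at h1
    · rw [gi hij]
  have Fbij : Function.Bijective F := by
    rw [Fintype.bijective_iff_injective_and_card]
    exact ⟨Finj, by simp [hn]⟩
  have adj : ∀ x y, G.Adj (F x) (F y) ↔ (KErr a b r).Adj x y := by
    rintro (_ | i | i) (_ | j | j)
    · simp [KErr]
    · simpa [KErr, F] using fS j
    · simpa [KErr, F] using gS j
    · rw [G.adj_comm]; simpa [KErr, F] using fS i
    · have : ¬ G.Adj (f i) (f j) := fun hh =>
        hu _ _ (fA i).1 (fA j).1 hh ((fA i).2.trans (fA j).2.symm)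
      simpa [KErr, F] using this
    · have : G.Adj (f i) (g j) := hu' _ _ (fA i).1 (gA j).1 (by rw [(fA i).2, (gA j).2]; simp)
      simpa [KErr, F] using this
    · rw [G.adj_comm]; simpa [KErr, F] using gS i
    · have : G.Adj (g i) (f j) := hu' _ _ (gA i).1 (fA j).1 (by rw [(gA i).2, (fA j).2]; simp)
      simpa [KErr, F] using this
    · have : ¬ G.Adj (g i) (g j) := fun hh =>
        hu _ _ (gA i).1 (gA j).1 hh ((gA i).2.trans (gA j).2.symm)
      simpa [KErr, F] using this
  let I : KErr a b r ≃g G :=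
    { toEquiv := Equiv.ofBijective F Fbij
      map_rel_iff' := fun {x y} => adj x y }
  exact ⟨I.symm⟩

lemma parts (p q n : ℕ) (hpq : p + q + 1 = n) (hle : p ≤ q)
    (hF : p * q = (n - 1) ^ 2 / 4) : p = (n - 1) / 2 ∧ q = n / 2 := by
  subst hpq
  obtain ⟨d, rfl⟩ := Nat.exists_eq_add_of_le hle
  have h1 : (p + (p + d) + 1 - 1) ^ 2 = 4 * (p * (p + d)) + d ^ 2 := by
    rw [Nat.add_sub_cancel]; ring
  rw [h1] at hF
  have : d ^ 2 < 4 := by omega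
  have : d < 2 := by nlinarith
  omega

end
end BookAux

/-- For every integer `r ≥ 2` and all sufficiently large `n`: every non-bipartite
`B_{r+1}`-free simple graph on `n` vertices with exactly `⌊(n-1)²/4⌋ + 2r` edges is
isomorphic to `K^{r,r}_{⌊(n-1)/2⌋, ⌈(n-1)/2⌉}`. -/
theorem stmt_3 (r : ℕ) (hr : 2 ≤ r) :
    ∃ n₀ : ℕ, ∀ n : ℕ, n₀ ≤ n →
      ∀ G : SimpleGraph (Fin n), ¬ G.Colorable 2 → BookFree r G →
        G.edgeSet.ncard = (n - 1) ^ 2 / 4 + 2 * r →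
        Nonempty (G ≃g KErr ((n - 1) / 2) (n / 2) r) := by
  refine ⟨100000 * (r + 1) ^ 3, fun n hn G hcol hB hE => ?_⟩
  have hn1 : 1 ≤ n := le_trans (by nlinarith [Nat.one_le_pow 3 (r + 1) (by omega)]) hn
  have hE1 : ((n : ℤ) - 1) ^ 2 ≤ 2 * ∑ x, ∑ y, BookAux.av G x y := by
    rw [BookAux.edges, hE]
    have h1 : (n - 1) ^ 2 < 4 * ((n - 1) ^ 2 / 4) + 4 := by omega
    zify [hn1] at h1 hr
    push_cast [hn1]
    linarith
  obtain ⟨c, u, hu⟩ := BookAux.apex G (r : ℤ) (n : ℤ) (by exact_mod_cast hr)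
    (by exact_mod_cast hn) rfl hB (by simp) hE1 hcol
  have main : ∀ c : Fin n → Bool, (∀ x y, x ≠ u → y ≠ u → G.Adj x y → c x ≠ c y) →
      ∑ x, BookAux.sd c u true x ≤ ∑ x, BookAux.sd c u false x →
      Nonempty (G ≃g KErr ((n - 1) / 2) (n / 2) r) := by
    intro c hu hle
    obtain ⟨h1, h2, h3, h4, h5⟩ := BookAux.apex_struct G c hr hB hcol u hu (by simpa using hE)
    have nn : ∀ b, 0 ≤ ∑ x, BookAux.sd c u b x := fun b => Finset.sum_nonneg fun x _ => by
      rcases BookAux.sd_cases c u b x with h | h <;> simp [h]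
    obtain ⟨p, hp⟩ := Int.eq_ofNat_of_zero_le (nn true)
    obtain ⟨q, hq⟩ := Int.eq_ofNat_of_zero_le (nn false)
    rw [hp, hq] at h4 h5 hle
    rw [Fintype.card_fin] at h4 h5
    have h5' : p + q + 1 = n := by omega
    obtain ⟨rfl, rfl⟩ := BookAux.parts p q n h5' (by exact_mod_cast hle) (by exact_mod_cast h4)
    exact BookAux.build G c u _ _ hu h3 h1 h2 hp hq (by rw [Fintype.card_fin]; omega)
  rcases le_total (∑ x, BookAux.sd c u true x) (∑ x, BookAux.sd c u false x) with hle | hle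
  · exact main c hu hle
  · refine main (fun x => !c x) (fun x y hx hy hxy => by simpa using hu x y hx hy hxy) ?_
    have : ∀ b, ∑ x, BookAux.sd (fun x => !c x) u b x = ∑ x, BookAux.sd c u (!b) x := by
      intro b
      refine Finset.sum_congr rfl fun x _ => ?_
      unfold BookAux.sd
      cases b <;> cases hc : c x <;> simp [hc]
    rw [this, this]
    exact hle
end

section
/- For all sufficiently large n, if G is a non-bipartite B₂-free simple graph on n vertices with e(G) = ⌊(n−1)²/4⌋ + 2, then G is isomorphic to a graph in the family 𝒢₁(B₂). -/
open SimpleGraph Set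

/-- The member of the family `𝒢₁(B₂)` determined by `S₁ ⊆ S* = Fin a` and `T₁ ⊆ T* = Fin b`:
it is obtained from the complete bipartite graph with parts `S*`, `T*` and a disjoint triangle
`w₁w₂w₃` (the three elements `0, 1, 2` of `Fin 3`) by joining `w₃` to all vertices of
`S₁ ∪ T₁`, `w₁` to all vertices of `S* \ S₁`, and `w₂` to all vertices of `T* \ T₁`. -/
def G1B2 (a b : ℕ) (S1 : Finset (Fin a)) (T1 : Finset (Fin b)) :
    SimpleGraph (Fin a ⊕ Fin b ⊕ Fin 3) :=
  SimpleGraph.fromRel (fun x y =>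
    (∃ (i : Fin a) (j : Fin b), x = Sum.inl i ∧ y = Sum.inr (Sum.inl j)) ∨
    (∃ k l : Fin 3, k ≠ l ∧ x = Sum.inr (Sum.inr k) ∧ y = Sum.inr (Sum.inr l)) ∨
    (∃ i ∈ S1, x = Sum.inr (Sum.inr 2) ∧ y = Sum.inl i) ∨
    (∃ j ∈ T1, x = Sum.inr (Sum.inr 2) ∧ y = Sum.inr (Sum.inl j)) ∨
    (∃ i : Fin a, i ∉ S1 ∧ x = Sum.inr (Sum.inr 0) ∧ y = Sum.inl i) ∨
    (∃ j : Fin b, j ∉ T1 ∧ x = Sum.inr (Sum.inr 1) ∧ y = Sum.inr (Sum.inl j)))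

theorem bf_false {V : Type*} [Finite V] {G : SimpleGraph V} (h : BookFree 1 G) {u v x y : V}
    (huv : G.Adj u v) (hux : G.Adj u x) (hvx : G.Adj v x) (huy : G.Adj u y) (hvy : G.Adj v y) :
    x = y :=
  (Set.ncard_le_one (Set.toFinite _)).1 (h u v huv) x ⟨hux, hvx⟩ y ⟨huy, hvy⟩

theorem bf_induce {V : Type*} [Finite V] {G : SimpleGraph V} (h : BookFree 1 G) (s : Set V) :
    BookFree 1 (G.induce s) := by
  intro u v huv
  rw [Set.ncard_le_one (Set.toFinite _)]
  intro x hx y hy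
  exact Subtype.ext (bf_false h (u := u) (v := v) huv hx.1 hx.2 hy.1 hy.2)

theorem mantel {V : Type*} [Fintype V] (G : SimpleGraph V) (h : G.CliqueFree 3) :
    4 * G.edgeSet.ncard ≤ Fintype.card V ^ 2 := by
  classical
  have := CliqueFree.card_edgeFinset_le (G := G) (r := 2) h
  simp only at this
  rw [Set.ncard_eq_toFinset_card']
  change 4 * G.edgeFinset.card ≤ _
  rcases Nat.mod_two_eq_zero_or_one (Fintype.card V) with h0 | h0 <;> rw [h0] at this <;>
    simp at this <;> omega

/-- Triangle-free non-bipartite graphs have at most `(n-1)²/4 + 1` edges. -/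
theorem tf_nonbip {V : Type*} [Fintype V] [Nonempty V] (G : SimpleGraph V)
    (h : ∀ a b c, G.Adj a b → G.Adj a c → G.Adj b c → False)
    (hc : ¬ G.Colorable 2) :
    4 * G.edgeSet.ncard ≤ (Fintype.card V - 1) ^ 2 + 4 := by
  classical
  obtain ⟨v, hv⟩ := G.exists_maximal_degree_vertex
  have hΔ : ∀ u, G.degree u ≤ G.degree v := fun u => hv ▸ G.degree_le_maxDegree u
  obtain ⟨x, y, hxy, hxv, hyv⟩ : ∃ x y, G.Adj x y ∧ ¬ G.Adj v x ∧ ¬ G.Adj v y := by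
    by_contra hcon
    push Not at hcon
    apply hc
    refine ⟨Coloring.mk (fun u => if G.Adj v u then (0 : Fin 2) else 1) ?_⟩
    intro a b hab
    by_cases ha : G.Adj v a
    · by_cases hb : G.Adj v b
      · exact (h _ _ _ ha hb hab).elim
      · simp [ha, hb]
    · have := hcon a b hab ha
      simp [ha, this]
  set A := G.neighborFinset v with hA
  set B : Finset V := Finset.univ \ (insert x (insert y A)) with hB
  have hne : x ≠ y := hxy.ne
  have hcard : (insert x (insert y A)).card = G.degree v + 2 := by
    rw [Finset.card_insert_of_notMem, Finset.card_insert_of_notMem, hA, card_neighborFinset_eq_degree]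
    · simpa [hA] using hyv
    · simp [hA, hne, hxv]
  have hBc : B.card + (G.degree v + 2) = Fintype.card V := by
    rw [← hcard, hB]
    exact Finset.card_sdiff_add_card_eq_card (Finset.subset_univ _)
  have hsub : G.edgeFinset ⊆ (B.biUnion fun u => G.incidenceFinset u) ∪
      (A.image (fun a => s(a, if G.Adj a x then x else y)) ∪ {s(x, y)}) := by
    intro e he
    induction e using Sym2.ind with
    | _ p q =>
      have hpq : G.Adj p q := by simpa using he
      simp only [Finset.mem_union, Finset.mem_biUnion, Finset.mem_image, Finset.mem_singleton]
      by_cases hp : p ∈ B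
      · left; exact ⟨p, hp, by simp [hpq]⟩
      by_cases hq : q ∈ B
      · left; exact ⟨q, hq, by simp [hpq, incidenceSet]⟩
      right
      simp only [hB, hA, Finset.mem_sdiff, Finset.mem_univ, true_and, not_not, Finset.mem_insert,
        mem_neighborFinset] at hp hq
      have key : ∀ a b, G.Adj v a → G.Adj a b → (b = x ∨ b = y) →
          s(a, if G.Adj a x then x else y) = s(a, b) := by
        rintro a b _ hab (rfl | rfl)
        · simp [hab]
        · have : ¬ G.Adj a x := fun hax => h _ _ _ hax hab hxy
          simp [this]
      by_cases hvp : G.Adj v p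
      · left
        refine ⟨p, by simpa [hA] using hvp, key _ _ hvp hpq ?_⟩
        rcases hq with h1 | h1 | h1
        · exact Or.inl h1
        · exact Or.inr h1
        · exact (h _ _ _ hvp h1 hpq).elim
      by_cases hvq : G.Adj v q
      · left
        refine ⟨q, by simpa [hA] using hvq, (key _ _ hvq hpq.symm ?_).trans Sym2.eq_swap⟩
        tauto
      · right
        have := hpq.ne
        rcases hp with h1 | h1 | h1 <;> rcases hq with h2 | h2 | h2 <;> subst_vars <;>
          first | rfl | exact Sym2.eq_swap | contradiction
  have hle := Finset.card_le_card hsub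
  have h1 := hle.trans (Finset.card_union_le _ _)
  have h2 : (B.biUnion fun u => G.incidenceFinset u).card ≤ B.card * G.degree v := by
    apply Finset.card_biUnion_le_card_mul
    intro u _
    rw [card_incidenceFinset_eq_degree]
    exact hΔ u
  have h3 : (A.image (fun a => s(a, if G.Adj a x then x else y)) ∪ {s(x, y)}).card
      ≤ G.degree v + 1 := by
    refine (Finset.card_union_le _ _).trans ?_
    have := Finset.card_image_le (s := A) (f := fun a => s(a, if G.Adj a x then x else y))
    rw [hA, card_neighborFinset_eq_degree] at this
    simpa using this
  rw [Set.ncard_eq_toFinset_card']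
  change 4 * G.edgeFinset.card ≤ _
  rw [← hBc]
  have h4 : G.edgeFinset.card ≤ B.card * G.degree v + (G.degree v + 1) := by omega
  have h5 : B.card + (G.degree v + 2) - 1 = B.card + 1 + G.degree v := by omega
  rw [h5]
  zify at h4 ⊢
  nlinarith [sq_nonneg ((B.card : ℤ) + 1 - G.degree v)]

theorem tri_count {V : Type*} [Fintype V] (G : SimpleGraph V) (w : Fin 3 → V) :
    G.edgeSet.ncard ≤ 3 + {u | u ∉ Set.range w ∧ ∃ k, G.Adj u (w k)}.ncard +
      (G.induce (Set.range w)ᶜ).edgeSet.ncard ∨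
    ∃ u, u ∉ Set.range w ∧ ∃ k l, k ≠ l ∧ G.Adj u (w k) ∧ G.Adj u (w l) := by
  classical
  by_cases hcon : ∃ u, u ∉ Set.range w ∧ ∃ k l, k ≠ l ∧ G.Adj u (w k) ∧ G.Adj u (w l)
  · exact Or.inr hcon
  left
  push Not at hcon
  let U : Set V := {u | u ∉ Set.range w ∧ ∃ k, G.Adj u (w k)}
  have ht : ∀ u, ∃ k, u ∈ U → G.Adj u (w k) := by
    intro u
    by_cases hu : u ∈ U
    · obtain ⟨k, hk⟩ := hu.2
      exact ⟨k, fun _ => hk⟩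
    · exact ⟨0, fun h => (hu h).elim⟩
  choose t ht using ht
  have key : ∀ u k, u ∉ Set.range w → G.Adj u (w k) → u ∈ U ∧ s(u, w (t u)) = s(u, w k) := by
    intro u k hu hk
    have hU : u ∈ U := ⟨hu, k, hk⟩
    refine ⟨hU, ?_⟩
    by_contra hne
    have : t u ≠ k := fun h => hne (by rw [h])
    exact hcon u hu _ _ this (ht u hU) hk
  let E3 : Set (Sym2 V) := {s(w 0, w 1), s(w 0, w 2), s(w 1, w 2)}
  have hsub : G.edgeSet ⊆ (E3 ∪ (fun u => s(u, w (t u))) '' U) ∪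
      (Sym2.map Subtype.val) '' (G.induce (Set.range w)ᶜ).edgeSet := by
    intro e he
    induction e using Sym2.ind with
    | _ p q =>
      have hpq : G.Adj p q := he
      by_cases hp : p ∈ Set.range w
      · left
        obtain ⟨k, rfl⟩ := hp
        by_cases hq : q ∈ Set.range w
        · left
          obtain ⟨l, rfl⟩ := hq
          have hkl : k ≠ l := fun h => hpq.ne (by rw [h])
          fin_cases k <;> fin_cases l <;> simp [E3, Sym2.eq_swap] at hkl ⊢
        · right
          have := key q k hq hpq.symm
          exact ⟨q, this.1, this.2.trans Sym2.eq_swap⟩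
      · by_cases hq : q ∈ Set.range w
        · left; right
          obtain ⟨l, rfl⟩ := hq
          have := key p l hp hpq
          exact ⟨p, this.1, this.2⟩
        · right
          exact ⟨s(⟨p, hp⟩, ⟨q, hq⟩), hpq, rfl⟩
  have h1 := Set.ncard_le_ncard hsub (Set.toFinite _)
  have h2 := Set.ncard_union_le (E3 ∪ (fun u => s(u, w (t u))) '' U)
    ((Sym2.map Subtype.val) '' (G.induce (Set.range w)ᶜ).edgeSet)
  have h3 := Set.ncard_union_le E3 ((fun u => s(u, w (t u))) '' U)
  have h4 := Set.ncard_image_le (s := U) (f := fun u => s(u, w (t u))) (Set.toFinite _)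
  have h5 := Set.ncard_image_le (s := (G.induce (Set.range w)ᶜ).edgeSet)
    (f := Sym2.map Subtype.val) (Set.toFinite _)
  have h6 : E3.ncard ≤ 3 := by
    refine (Set.ncard_insert_le _ _).trans ?_
    have := Set.ncard_insert_le s(w 0, w 2) {s(w 1, w 2)}
    rw [Set.ncard_singleton] at this
    omega
  change _ ≤ 3 + U.ncard + _
  omega

theorem tri_count' {V : Type*} [Fintype V] (G : SimpleGraph V) (hG : BookFree 1 G)
    (w : Fin 3 → V) (hw : ∀ k l, k ≠ l → G.Adj (w k) (w l)) :
    (∀ u, u ∉ Set.range w → ∀ k l, G.Adj u (w k) → G.Adj u (w l) → k = l) ∧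
    G.edgeSet.ncard ≤ 3 + {u | u ∉ Set.range w ∧ ∃ k, G.Adj u (w k)}.ncard +
      (G.induce (Set.range w)ᶜ).edgeSet.ncard := by
  have key : ∀ u, u ∉ Set.range w → ∀ k l, G.Adj u (w k) → G.Adj u (w l) → k = l := by
    intro u hu k l hk hl
    by_contra hkl
    obtain ⟨m, hmk, hml⟩ : ∃ m : Fin 3, m ≠ k ∧ m ≠ l := by
      clear hk hl hkl
      revert k l; decide
    exact hu ⟨m, bf_false hG (hw k l hkl) (hw k m hmk.symm) (hw l m hml.symm) hk.symm hl.symm⟩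
  refine ⟨key, ?_⟩
  rcases tri_count G w with h | ⟨u, hu, k, l, hkl, h1, h2⟩
  · exact h
  · exact (hkl (key u hu k l h1 h2)).elim

theorem card_compl_w {V : Type*} [Fintype V] (w : Fin 3 → V) (hw : Function.Injective w) :
    (Set.range w)ᶜ.ncard + 3 = Fintype.card V := by
  have h1 : (Set.range w).ncard = 3 := by
    rw [← Set.image_univ, Set.ncard_image_of_injective _ hw]
    simp [Set.ncard_univ]
  have := Set.ncard_add_ncard_compl (Set.range w)
  rw [Nat.card_eq_fintype_card] at this
  omega

theorem exists_tri {V : Type*} (G : SimpleGraph V)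
    (h : ¬ ∀ a b c, G.Adj a b → G.Adj a c → G.Adj b c → False) :
    ∃ w : Fin 3 → V, ∀ k l, k ≠ l → G.Adj (w k) (w l) := by
  push Not at h
  obtain ⟨a, b, c, hab, hac, hbc, -⟩ := h
  refine ⟨![a, b, c], ?_⟩
  intro k l hkl
  fin_cases k <;> fin_cases l <;> simp [hab, hac, hbc, hab.symm, hac.symm, hbc.symm] at hkl ⊢

theorem cf_of {V : Type*} (G : SimpleGraph V)
    (h : ∀ a b c, G.Adj a b → G.Adj a c → G.Adj b c → False) : G.CliqueFree 3 := by
  classical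
  intro s hs
  obtain ⟨a, b, c, hab, hac, hbc, -⟩ := is3Clique_iff.1 hs
  exact h a b c hab hac hbc

theorem tri_bound {V : Type*} [Fintype V] (G : SimpleGraph V) (hG : BookFree 1 G)
    (w : Fin 3 → V) (hw : ∀ k l, k ≠ l → G.Adj (w k) (w l)) :
    G.edgeSet.ncard ≤ Fintype.card V + (G.induce (Set.range w)ᶜ).edgeSet.ncard := by
  have h1 := (tri_count' G hG w hw).2
  have hinj : Function.Injective w := by
    intro k l hkl
    by_contra hne
    exact (hw k l hne).ne hkl
  have h2 := card_compl_w w hinj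
  have h3 : {u | u ∉ Set.range w ∧ ∃ k, G.Adj u (w k)}.ncard ≤ (Set.range w)ᶜ.ncard :=
    Set.ncard_le_ncard (fun u hu => hu.1) (Set.toFinite _)
  omega

theorem weak_bound : ∀ (m : ℕ) {V : Type} [Fintype V] (G : SimpleGraph V), Fintype.card V = m →
    BookFree 1 G → 4 * G.edgeSet.ncard ≤ m ^ 2 + 4 := by
  classical
  intro m
  induction m using Nat.strong_induction_on with
  | _ m ih =>
  intro V _ G hm hG
  by_cases htf : ∀ a b c, G.Adj a b → G.Adj a c → G.Adj b c → False
  · have := mantel G (cf_of G htf)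
    rw [hm] at this
    omega
  obtain ⟨w, hw⟩ := exists_tri G htf
  have hinj : Function.Injective w := by
    intro k l hkl
    by_contra hne
    exact (hw k l hne).ne hkl
  have h2 := card_compl_w w hinj
  have h1 := tri_bound G hG w hw
  have h4 : Fintype.card ↥((Set.range w)ᶜ) = (Set.range w)ᶜ.ncard := by
    rw [← Nat.card_eq_fintype_card, Nat.card_coe_set_eq]
  rw [hm] at h1 h2
  by_cases hm5 : 5 ≤ m
  · have h3 := ih ((Set.range w)ᶜ.ncard) (by omega) (G.induce (Set.range w)ᶜ) h4 (bf_induce hG _)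
    set r := (Set.range w)ᶜ.ncard
    subst h2
    nlinarith
  · have h5 : (G.induce (Set.range w)ᶜ).edgeSet.ncard = 0 := by
      rw [Set.ncard_eq_zero]
      have hs : (Set.range w)ᶜ.Subsingleton := by
        intro p hp q hq
        exact (Set.ncard_le_one (Set.toFinite _)).1 (by omega) p hp q hq
      ext e
      induction e using Sym2.ind with
      | _ p q =>
        simp only [mem_edgeSet, comap_adj, Set.mem_empty_iff_false, iff_false]
        intro hpq
        exact hpq.ne (hs p.2 q.2)
    have : m = 3 ∨ m = 4 := by omega
    rcases this with rfl | rfl <;> omega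

theorem turan_iso {V : Type} [Fintype V] (G : SimpleGraph V) (hG : BookFree 1 G)
    (hm : 9 ≤ Fintype.card V) (he : Fintype.card V ^ 2 / 4 ≤ G.edgeSet.ncard) :
    G.edgeSet.ncard = Fintype.card V ^ 2 / 4 ∧
      Nonempty (G ≃g turanGraph (Fintype.card V) 2) := by
  classical
  have htf : ∀ a b c, G.Adj a b → G.Adj a c → G.Adj b c → False := by
    by_contra htf
    obtain ⟨w, hw⟩ := exists_tri G htf
    have hinj : Function.Injective w := by
      intro k l hkl
      by_contra hne
      exact (hw k l hne).ne hkl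
    have h2 := card_compl_w w hinj
    have h1 := tri_bound G hG w hw
    have h4 : Fintype.card ↥((Set.range w)ᶜ) = (Set.range w)ᶜ.ncard := by
      rw [← Nat.card_eq_fintype_card, Nat.card_coe_set_eq]
    have h3 := weak_bound _ (G.induce (Set.range w)ᶜ) h4 (bf_induce hG _)
    set r := (Set.range w)ᶜ.ncard
    rw [← h2] at h1 he hm
    have h6 : (r + 3) ^ 2 < 4 * (G.edgeSet.ncard + 1) := by omega
    nlinarith
  have hcf := cf_of G htf
  have hM := mantel G hcf
  refine ⟨by omega, ?_⟩
  rw [← isTuranMaximal_iff_nonempty_iso_turanGraph (by norm_num)]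
  refine ⟨hcf, ?_⟩
  intro H _ hH
  have hM' := mantel H hH
  rw [Set.ncard_eq_toFinset_card'] at hM' he
  change 4 * H.edgeFinset.card ≤ _ at hM'
  change _ ≤ G.edgeFinset.card at he
  omega

theorem final_iso {n a b : ℕ} (G : SimpleGraph (Fin n)) (hn : a + b + 3 = n)
    (f : Fin a → Fin n) (g : Fin b → Fin n) (w : Fin 3 → Fin n)
    (hf : Function.Injective f) (hg : Function.Injective g)
    (hw : ∀ k l, k ≠ l → G.Adj (w k) (w l))
    (hfw : ∀ i, f i ∉ Set.range w) (hgw : ∀ i, g i ∉ Set.range w)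
    (hff : ∀ i j, ¬ G.Adj (f i) (f j)) (hgg : ∀ i j, ¬ G.Adj (g i) (g j))
    (hfg : ∀ i j, G.Adj (f i) (g j))
    (S1 : Finset (Fin a)) (T1 : Finset (Fin b))
    (h0 : ∀ i, G.Adj (f i) (w 0) ↔ i ∉ S1) (h1 : ∀ i, ¬ G.Adj (f i) (w 1))
    (h2 : ∀ i, G.Adj (f i) (w 2) ↔ i ∈ S1)
    (k0 : ∀ i, ¬ G.Adj (g i) (w 0)) (k1 : ∀ i, G.Adj (g i) (w 1) ↔ i ∉ T1)
    (k2 : ∀ i, G.Adj (g i) (w 2) ↔ i ∈ T1) :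
    Nonempty (G ≃g G1B2 a b S1 T1) := by
  classical
  have hinj : Function.Injective w := by
    intro k l hkl
    by_contra hne
    exact (hw k l hne).ne hkl
  let F : Fin a ⊕ Fin b ⊕ Fin 3 → Fin n := Sum.elim f (Sum.elim g w)
  have hF : Function.Injective F := by
    apply hf.sumElim (hg.sumElim hinj _)
    · rintro i (j | k)
      · exact (hfg i j).ne
      · exact fun h => hfw i ⟨k, h.symm⟩
    · exact fun j k h => hgw j ⟨k, h.symm⟩
  have hbij : Function.Bijective F := by
    rw [Fintype.bijective_iff_injective_and_card]
    refine ⟨hF, by simp; omega⟩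
  have hww : ∀ k l, G.Adj (w k) (w l) ↔ k ≠ l :=
    fun k l => ⟨fun h e => h.ne (by rw [e]), hw k l⟩
  refine ⟨Iso.symm ⟨Equiv.ofBijective F hbij, ?_⟩⟩
  have hfw' : ∀ i k, G.Adj (f i) (w k) ↔ (G1B2 a b S1 T1).Adj (Sum.inl i) (Sum.inr (Sum.inr k)) := by
    intro i k
    fin_cases k <;> simp [G1B2, h0, h1, h2]
  have hgw' : ∀ i k, G.Adj (g i) (w k) ↔
      (G1B2 a b S1 T1).Adj (Sum.inr (Sum.inl i)) (Sum.inr (Sum.inr k)) := by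
    intro i k
    fin_cases k <;> simp [G1B2, k0, k1, k2]
  rintro (i | j | k) (i' | j' | k') <;> simp only [Equiv.ofBijective_apply, F, Sum.elim_inl, Sum.elim_inr]
  · simp [hff, G1B2]
  · simp [hfg, G1B2]
  · exact hfw' _ _
  · simp [(hfg _ _).symm, G1B2]
  · simp [hgg, G1B2]
  · exact hgw' _ _
  · exact (G.adj_comm _ _).trans ((hfw' _ _).trans (SimpleGraph.adj_comm _ _ _))
  · exact (G.adj_comm _ _).trans ((hgw' _ _).trans (SimpleGraph.adj_comm _ _ _))
  · rw [hww]; simp [G1B2]; tauto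

/-- For all sufficiently large `n`: every non-bipartite `B₂`-free simple graph on `n` vertices
with exactly `⌊(n-1)²/4⌋ + 2` edges is isomorphic to a graph of the family `𝒢₁(B₂)`. -/
theorem stmt_4 :
    ∃ n₀ : ℕ, ∀ n : ℕ, n₀ ≤ n →
      ∀ G : SimpleGraph (Fin n), ¬ G.Colorable 2 → BookFree 1 G →
        G.edgeSet.ncard = (n - 1) ^ 2 / 4 + 2 →
        ∃ (S1 : Finset (Fin ((n - 3) / 2))) (T1 : Finset (Fin ((n - 2) / 2))),
          S1.card * T1.card ≤ 1 ∧
          Nonempty (G ≃g G1B2 ((n - 3) / 2) ((n - 2) / 2) S1 T1) := by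
  classical
  refine ⟨20, ?_⟩
  intro n hn G hc hG he
  have hsq : 4 * ((n - 1) ^ 2 / 4) + 4 > (n - 1) ^ 2 := by omega
  have htf : ¬ ∀ a b c, G.Adj a b → G.Adj a c → G.Adj b c → False := by
    intro h
    haveI : Nonempty (Fin n) := ⟨⟨0, by omega⟩⟩
    have := tf_nonbip G h hc
    rw [Fintype.card_fin] at this
    omega
  obtain ⟨w, hw⟩ := exists_tri G htf
  have hinj : Function.Injective w := by
    intro k l hkl
    by_contra hne
    exact (hw k l hne).ne hkl
  have h2 := card_compl_w w hinj
  obtain ⟨huniq, h1⟩ := tri_count' G hG w hw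
  have h3 : {u | u ∉ Set.range w ∧ ∃ k, G.Adj u (w k)} ⊆ (Set.range w)ᶜ := fun u hu => hu.1
  have h3' := Set.ncard_le_ncard h3 (Set.toFinite _)
  have h4 : Fintype.card ↥((Set.range w)ᶜ) = n - 3 := by
    rw [← Nat.card_eq_fintype_card, Nat.card_coe_set_eq]
    rw [Fintype.card_fin] at h2
    omega
  rw [Fintype.card_fin] at h2
  have hq : (n - 1) ^ 2 / 4 + 2 = 3 + (n - 3) + (n - 3) ^ 2 / 4 := by
    obtain ⟨k, rfl⟩ : ∃ k, n = k + 3 := ⟨n - 3, by omega⟩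
    have : (k + 3 - 1) ^ 2 = k ^ 2 + 4 * (k + 1) := by
      rw [show k + 3 - 1 = k + 2 by omega]; ring
    rw [this, show k + 3 - 3 = k by omega]
    omega
  obtain ⟨he', ⟨φ⟩⟩ := turan_iso (G.induce (Set.range w)ᶜ) (bf_induce hG _) (by omega)
    (by rw [h4]; omega)
  rw [h4] at he'
  have heq := Set.eq_of_subset_of_ncard_le h3 (by omega) (Set.toFinite _)
  have hex : ∀ u, u ∉ Set.range w → ∃ k, G.Adj u (w k) := by
    intro u hu
    have : u ∈ (Set.range w)ᶜ := hu
    rw [← heq] at this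
    exact this.2
  rw [h4] at φ
  let ψ := φ.symm
  let f : Fin ((n - 3) / 2) → Fin n := fun i => (ψ ⟨2 * i + 1, by omega⟩ : (Set.range w)ᶜ.Elem)
  let g : Fin ((n - 2) / 2) → Fin n := fun i => (ψ ⟨2 * i, by omega⟩ : (Set.range w)ᶜ.Elem)
  have hadj : ∀ x y, G.Adj (ψ x : (Set.range w)ᶜ.Elem) (ψ y : (Set.range w)ᶜ.Elem) ↔
      (x : ℕ) % 2 ≠ y % 2 := by
    intro x y
    have := ψ.map_rel_iff (a := x) (b := y)
    simpa [turanGraph_adj] using this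
  have hf : Function.Injective f := by
    intro i j hij
    have := ψ.injective (Subtype.ext hij)
    simp only [Fin.mk.injEq] at this
    ext; omega
  have hg : Function.Injective g := by
    intro i j hij
    have := ψ.injective (Subtype.ext hij)
    simp only [Fin.mk.injEq] at this
    ext; omega
  have hfw : ∀ i, f i ∉ Set.range w := fun i => Subtype.property (ψ _)
  have hgw : ∀ i, g i ∉ Set.range w := fun i => Subtype.property (ψ _)
  have hff : ∀ i j, ¬ G.Adj (f i) (f j) := by
    intro i j h
    have := (hadj _ _).1 h
    simp only at this
    omega
  have hgg : ∀ i j, ¬ G.Adj (g i) (g j) := by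
    intro i j h
    have := (hadj _ _).1 h
    simp only at this
    omega
  have hfg : ∀ i j, G.Adj (f i) (g j) := by
    intro i j
    refine (hadj _ _).2 ?_
    simp only
    omega
  have hp : ∀ i, ∃ k, ∀ l, G.Adj (f i) (w l) ↔ k = l := by
    intro i
    obtain ⟨k, hk⟩ := hex _ (hfw i)
    exact ⟨k, fun l => ⟨fun h => huniq _ (hfw i) _ _ hk h, fun h => h ▸ hk⟩⟩
  have hr : ∀ i, ∃ k, ∀ l, G.Adj (g i) (w l) ↔ k = l := by
    intro i
    obtain ⟨k, hk⟩ := hex _ (hgw i)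
    exact ⟨k, fun l => ⟨fun h => huniq _ (hgw i) _ _ hk h, fun h => h ▸ hk⟩⟩
  choose p hp using hp
  choose r hr using hr
  have hpp : ∀ i i' j, p i = p i' → p i = r j → i = i' := by
    intro i i' j h h'
    apply hf
    exact bf_false hG (u := w (p i)) (v := g j) ((hr j _).2 h'.symm).symm
      ((hp i _).2 rfl).symm (hfg _ _).symm ((hp i' _).2 h.symm).symm (hfg _ _).symm
  have hrr : ∀ j j' i, r j = r j' → p i = r j → j = j' := by
    intro j j' i h h'
    apply hg
    exact bf_false hG (u := w (r j)) (v := f i) ((hp i _).2 h').symm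
      ((hr j _).2 rfl).symm (hfg _ _) ((hr j' _).2 h.symm).symm (hfg _ _)
  obtain ⟨i, i', hii, hpi⟩ := Fintype.exists_ne_map_eq_of_card_lt p (by simp; omega)
  obtain ⟨j, j', hjj, hrj⟩ := Fintype.exists_ne_map_eq_of_card_lt r (by simp; omega)
  have hA : ∀ x, r x ≠ p i := fun x h => hii (hpp i i' x hpi h.symm)
  have hB : ∀ x, p x ≠ r j := fun x h => hjj (hrr j j' x hrj h)
  obtain ⟨k, hk1, hk2, hk3⟩ : ∃ k : Fin 3, k ≠ p i ∧ k ≠ r j ∧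
      ∀ l, l = p i ∨ l = r j ∨ l = k := by
    have := hA j
    revert this
    generalize p i = x
    generalize r j = y
    revert x y
    decide
  have hAB : p i ≠ r j := hB i
  refine ⟨Finset.univ.filter (fun x => p x = k), Finset.univ.filter (fun x => r x = k), ?_, ?_⟩
  · set S1 := Finset.univ.filter (fun x => p x = k) with hS1
    set T1 := Finset.univ.filter (fun x => r x = k) with hT1
    rcases S1.eq_empty_or_nonempty with h | ⟨s, hs⟩
    · simp [h]
    rcases T1.eq_empty_or_nonempty with h | ⟨t, ht⟩
    · simp [h]
    simp only [hS1, hT1, Finset.mem_filter, Finset.mem_univ, true_and] at hs ht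
    have c1 : S1.card ≤ 1 := by
      rw [Finset.card_le_one]
      intro x hx y hy
      simp only [hS1, Finset.mem_filter, Finset.mem_univ, true_and] at hx hy
      exact hpp x y t (hx.trans hy.symm) (hx.trans ht.symm)
    have c2 : T1.card ≤ 1 := by
      rw [Finset.card_le_one]
      intro x hx y hy
      simp only [hT1, Finset.mem_filter, Finset.mem_univ, true_and] at hx hy
      exact hrr x y s (hx.trans hy.symm) (hs.trans hx.symm)
    exact Nat.mul_le_mul c1 c2
  · let σ : Fin 3 → Fin 3 := ![p i, r j, k]
    have hσ : ∀ x y, x ≠ y → σ x ≠ σ y := by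
      intro x y hxy
      fin_cases x <;> fin_cases y <;>
        simp [σ, hAB, hAB.symm, hk1, hk1.symm, hk2, hk2.symm] at hxy ⊢
    have hran : ∀ v, v ∉ Set.range w → v ∉ Set.range (w ∘ σ) := by
      rintro v hv ⟨x, rfl⟩
      exact hv ⟨_, rfl⟩
    refine final_iso G (by omega) f g (w ∘ σ) hf hg (fun x y h => hw _ _ (hσ x y h))
      (fun x => hran _ (hfw x)) (fun x => hran _ (hgw x)) hff hgg hfg _ _ ?_ ?_ ?_ ?_ ?_ ?_
    · intro x
      simp only [Function.comp_apply, hp, Finset.mem_filter, Finset.mem_univ, true_and]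
      change p x = p i ↔ _
      have := hk3 (p x)
      have := hB x
      grind
    · intro x
      simp only [Function.comp_apply, hp]
      exact hB x
    · intro x
      simp only [Function.comp_apply, hp, Finset.mem_filter, Finset.mem_univ, true_and]
      rfl
    · intro x
      simp only [Function.comp_apply, hr]
      exact hA x
    · intro x
      simp only [Function.comp_apply, hr, Finset.mem_filter, Finset.mem_univ, true_and]
      change r x = r j ↔ _
      have := hk3 (r x)
      have := hA x
      grind
    · intro x
      simp only [Function.comp_apply, hr, Finset.mem_filter, Finset.mem_univ, true_and]
      rfl
end

section
/- Let r ≥ 1 be an integer. For all sufficiently large n, every non-bipartite B_{r+1}-free simple graph on n vertices whose adjacency matrix has maximum spectral radius among all such graphs also has the maximum number of edges among all non-bipartite B_{r+1}-free simple graphs on n vertices. -/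
open SimpleGraph Set

open Classical in
/-- The spectral radius of a graph `G` on `Fin n`: the largest eigenvalue (i.e. the supremum
of the set of eigenvalues) of its real adjacency matrix. -/
noncomputable def specRad {n : ℕ} (G : SimpleGraph (Fin n)) : ℝ :=
  sSup {μ : ℝ | ∃ v : Fin n → ℝ, v ≠ 0 ∧
    (Matrix.of fun i j => if G.Adj i j then (1 : ℝ) else 0).mulVec v = μ • v}


/-! ### Basic notions -/

open Classical in
/-- Neighbourhood as a finset. -/
noncomputable def nb {n : ℕ} (G : SimpleGraph (Fin n)) (i : Fin n) : Finset (Fin n) :=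
  Finset.univ.filter (fun j => G.Adj i j)

lemma mem_nb {n : ℕ} (G : SimpleGraph (Fin n)) (i j : Fin n) : j ∈ nb G i ↔ G.Adj i j := by
  simp [nb]

lemma mem_nb_comm {n : ℕ} (G : SimpleGraph (Fin n)) (i j : Fin n) : j ∈ nb G i ↔ i ∈ nb G j := by
  simp [nb, G.adj_comm]

lemma sum_nb_eq {n : ℕ} (G : SimpleGraph (Fin n)) :
    ∑ i, (nb G i).card = 2 * G.edgeSet.ncard := by
  classical
  have h := G.sum_degrees_eq_twice_card_edges
  rw [← SimpleGraph.coe_edgeFinset, Set.ncard_coe_finset, ← h]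
  apply Finset.sum_congr rfl
  intro i _
  rw [← SimpleGraph.card_neighborFinset_eq_degree]
  congr 1
  ext j
  simp [nb]

lemma book_nb {n r : ℕ} {G : SimpleGraph (Fin n)} (h : BookFree r G) {u v : Fin n}
    (huv : G.Adj u v) : (nb G u ∩ nb G v).card ≤ r := by
  have := h u v huv
  have e : ({w | G.Adj u w ∧ G.Adj v w} : Set (Fin n)) = ((nb G u ∩ nb G v : Finset (Fin n)) : Set (Fin n)) := by
    ext w; simp [nb]
  rwa [e, Set.ncard_coe_finset] at this

/-- Double counting: exchange of the order of summation over adjacent pairs. -/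
lemma sum_nb_comm {n : ℕ} {R : Type*} [AddCommMonoid R] (G : SimpleGraph (Fin n))
    (S T : Finset (Fin n)) (f : Fin n → Fin n → R) :
    ∑ i ∈ S, ∑ j ∈ nb G i ∩ T, f i j = ∑ j ∈ T, ∑ i ∈ nb G j ∩ S, f i j := by
  apply Finset.sum_comm'
  intro x y
  simp only [Finset.mem_inter, mem_nb]
  rw [G.adj_comm y x]
  tauto

lemma card_nb_comm {n : ℕ} (G : SimpleGraph (Fin n)) (S T : Finset (Fin n)) :
    ∑ i ∈ S, (nb G i ∩ T).card = ∑ j ∈ T, (nb G j ∩ S).card := by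
  simp only [Finset.card_eq_sum_ones]
  exact sum_nb_comm G S T (fun _ _ => 1)

/-! ### Spectral preliminaries -/

lemma spec_exists {n : ℕ} (hn : 0 < n) (G : SimpleGraph (Fin n)) :
    (∃ x : Fin n → ℝ, (∀ i, 0 ≤ x i) ∧ ∑ i, x i ^ 2 = 1 ∧
      ∀ i, ∑ j ∈ nb G i, x j = specRad G * x i) ∧
    (∀ y : Fin n → ℝ, ∑ i, ∑ j ∈ nb G i, y i * y j ≤ specRad G * ∑ i, y i ^ 2) := by
  classical
  set M : Matrix (Fin n) (Fin n) ℝ := Matrix.of fun i j => if G.Adj i j then (1 : ℝ) else 0 with hM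
  have hMv : ∀ (y : Fin n → ℝ) i, M.mulVec y i = ∑ j ∈ nb G i, y j := by
    intro y i
    simp [hM, Matrix.mulVec, dotProduct, nb, Finset.sum_filter]
  have hherm : M.IsHermitian := by
    ext i j
    simp [hM, Matrix.conjTranspose, G.adj_comm]
  let Q : (Fin n → ℝ) → ℝ := fun y => ∑ i, ∑ j ∈ nb G i, y i * y j
  have hQ : ∀ y, Q y = y ⬝ᵥ M.mulVec y := by
    intro y
    simp only [Q, dotProduct, hMv, Finset.mul_sum]
  -- maximise on the sphere
  let K : Set (Fin n → ℝ) := {y | ∑ i, y i ^ 2 = 1}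
  have hKc : IsCompact K := by
    apply Metric.isCompact_of_isClosed_isBounded
    · exact isClosed_eq (by fun_prop) continuous_const
    · apply (Metric.isBounded_closedBall (x := (0 : Fin n → ℝ)) (r := 1)).subset
      intro y hy
      rw [mem_closedBall_zero_iff, pi_norm_le_iff_of_nonneg zero_le_one]
      intro i
      rw [Real.norm_eq_abs, ← sq_le_one_iff_abs_le_one, ← (show ∑ i, y i ^ 2 = 1 from hy)]
      exact Finset.single_le_sum (f := fun i => y i ^ 2) (fun j _ => sq_nonneg (y j)) (Finset.mem_univ i)
  have hKne : K.Nonempty := by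
    refine ⟨Pi.single ⟨0, hn⟩ 1, ?_⟩
    simp only [K, Set.mem_ofPred_eq]
    rw [Finset.sum_eq_single ⟨0, hn⟩]
    · simp
    · intro b _ hb; simp [hb]
    · simp
  have hQc : Continuous Q := by fun_prop
  obtain ⟨x, hxK, hxmax⟩ := hKc.exists_isMaxOn hKne hQc.continuousOn
  have hRay : ∀ y : Fin n → ℝ, Q y ≤ Q x * ∑ i, y i ^ 2 := by
    intro y
    by_cases hy : ∑ i, y i ^ 2 = 0
    · have : ∀ i, y i = 0 := by
        intro i
        have := (Finset.sum_eq_zero_iff_of_nonneg (fun i _ => sq_nonneg (y i))).1 hy i (Finset.mem_univ i)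
        simpa using this
      simp [Q, this]
    · have hpos : 0 < ∑ i, y i ^ 2 :=
        lt_of_le_of_ne (Finset.sum_nonneg fun i _ => sq_nonneg (y i)) (Ne.symm hy)
      set s := ∑ i, y i ^ 2 with hs
      have hss : Real.sqrt s ^ 2 = s := Real.sq_sqrt hpos.le
      have hsp : 0 < Real.sqrt s := Real.sqrt_pos.2 hpos
      have hz : (fun i => y i / Real.sqrt s) ∈ K := by
        simp only [K, Set.mem_ofPred_eq, div_pow, hss]
        rw [← Finset.sum_div, ← hs, div_self hy]
      have h1 : Q (fun i => y i / Real.sqrt s) ≤ Q x := hxmax hz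
      have h2 : Q (fun i => y i / Real.sqrt s) = Q y / s := by
        simp only [Q]
        rw [Finset.sum_div]
        apply Finset.sum_congr rfl
        intro i _
        rw [Finset.sum_div]
        apply Finset.sum_congr rfl
        intro j _
        rw [div_mul_div_comm, ← pow_two, hss]
      rw [h2, div_le_iff₀ hpos] at h1
      exact h1
  -- the absolute value also attains the maximum
  let z : Fin n → ℝ := fun i => |x i|
  have hzK : ∑ i, z i ^ 2 = 1 := by simp only [z, sq_abs]; exact hxK
  have hzQ : Q x ≤ Q z := by
    apply Finset.sum_le_sum; intro i _
    apply Finset.sum_le_sum; intro j _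
    rw [← abs_mul]; exact le_abs_self _
  have hzQ' : Q z = Q x := le_antisymm (by have := hRay z; rwa [hzK, mul_one] at this) hzQ
  have hpsd : (Q x • (1 : Matrix (Fin n) (Fin n) ℝ) - M).PosSemidef := by
    apply Matrix.PosSemidef.of_dotProduct_mulVec_nonneg
    · apply Matrix.IsHermitian.sub _ hherm
      ext i j
      simp [Matrix.conjTranspose, Matrix.one_apply]
    · intro y
      have := hRay y
      rw [hQ y] at this
      simp only [Matrix.sub_mulVec, Matrix.smul_mulVec, Matrix.one_mulVec, dotProduct_sub, star_trivial]
      have e : y ⬝ᵥ (Q x • y) = Q x * ∑ i, y i ^ 2 := by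
        rw [dotProduct_smul, smul_eq_mul]; congr 1
        simp [dotProduct, pow_two]
      rw [e]; linarith
  have hker : M.mulVec z = Q x • z := by
    have := (hpsd.dotProduct_mulVec_zero_iff z).1 (by
      simp only [Matrix.sub_mulVec, Matrix.smul_mulVec, Matrix.one_mulVec, dotProduct_sub, star_trivial]
      rw [← hQ z, hzQ', dotProduct_smul, smul_eq_mul]
      have : z ⬝ᵥ z = 1 := by rw [← hzK]; simp [dotProduct, pow_two]
      rw [this]; ring)
    rw [Matrix.sub_mulVec, Matrix.smul_mulVec, Matrix.one_mulVec, sub_eq_zero] at this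
    exact this.symm
  have hz0 : z ≠ 0 := by
    intro h
    rw [h] at hzK
    simp at hzK
  have hspec : specRad G = Q x := by
    have hg : IsGreatest {μ : ℝ | ∃ v : Fin n → ℝ, v ≠ 0 ∧ M.mulVec v = μ • v} (Q x) := by
      refine ⟨⟨z, hz0, hker⟩, ?_⟩
      rintro μ ⟨v, hv0, hv⟩
      have h1 := hRay v
      rw [hQ v, hv, dotProduct_smul, smul_eq_mul] at h1
      have e : v ⬝ᵥ v = ∑ i, v i ^ 2 := by simp [dotProduct, pow_two]
      rw [e] at h1
      have hpos : 0 < ∑ i, v i ^ 2 := by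
        rw [← e]
        have : 0 ≤ v ⬝ᵥ v := by rw [e]; exact Finset.sum_nonneg fun i _ => sq_nonneg (v i)
        exact lt_of_le_of_ne this (fun h => hv0 (dotProduct_self_eq_zero.1 h.symm))
      exact le_of_mul_le_mul_right h1 hpos
    have := hg.csSup_eq
    rw [← this]
    unfold specRad
    congr! 
  refine ⟨⟨z, fun i => abs_nonneg _, hzK, ?_⟩, ?_⟩
  · intro i
    rw [← hMv, hker, hspec]; simp
  · intro y
    rw [hspec]; exact hRay y

/-! ### Edges versus spectral radius -/

lemma card_nb_le {n : ℕ} (G : SimpleGraph (Fin n)) (i : Fin n) : (nb G i).card ≤ n := by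
  simpa using (Finset.card_le_univ (nb G i))

lemma card_split {n : ℕ} (X Z : Finset (Fin n)) : X.card = (X ∩ Z).card + (X ∩ Zᶜ).card := by
  rw [← Finset.card_inter_add_card_sdiff X Z, Finset.sdiff_eq_inter_compl]

lemma two_sum_nb_le {n : ℕ} (G : SimpleGraph (Fin n)) (u : Fin n) :
    2 * ∑ w ∈ nb G u, (nb G w).card ≤
      2 * G.edgeSet.ncard + ∑ w ∈ nb G u, (nb G w ∩ nb G u).card := by
  rw [← sum_nb_eq, ← Finset.sum_add_sum_compl (nb G u)]
  have h1 : ∑ w ∈ (nb G u)ᶜ, (nb G w ∩ nb G u).card ≤ ∑ w ∈ (nb G u)ᶜ, (nb G w).card :=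
    Finset.sum_le_sum fun w _ => Finset.card_le_card Finset.inter_subset_left
  rw [card_nb_comm] at h1
  have h2 : ∑ w ∈ nb G u, (nb G w).card
      = ∑ w ∈ nb G u, (nb G w ∩ nb G u).card + ∑ w ∈ nb G u, (nb G w ∩ (nb G u)ᶜ).card := by
    rw [← Finset.sum_add_distrib]
    exact Finset.sum_congr rfl fun w _ => card_split _ _
  omega

/-- There is a vertex `u` of degree at least `ρ` with `ρ²` at most the sum of the degrees over
its neighbourhood. -/
lemma exists_max_vertex {n : ℕ} (hn : 0 < n) (G : SimpleGraph (Fin n)) :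
    ∃ u, specRad G ≤ (nb G u).card ∧
      specRad G ^ 2 ≤ ((∑ w ∈ nb G u, (nb G w).card : ℕ) : ℝ) := by
  obtain ⟨⟨x, hx0, hx1, hx⟩, -⟩ := spec_exists hn G
  have : Nonempty (Fin n) := ⟨⟨0, hn⟩⟩
  obtain ⟨u, hu⟩ := Finite.exists_max x
  have hpos : 0 < x u := by
    by_contra h
    have : ∀ i, x i = 0 := fun i => le_antisymm ((hu i).trans (not_lt.1 h)) (hx0 i)
    simp [this] at hx1
  have hb : ∀ w, ∑ z ∈ nb G w, x z ≤ (nb G w).card * x u := by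
    intro w
    calc ∑ z ∈ nb G w, x z ≤ ∑ z ∈ nb G w, x u := Finset.sum_le_sum fun z _ => hu z
      _ = _ := by simp
  refine ⟨u, ?_, ?_⟩
  · have := hb u
    rw [hx u] at this
    exact le_of_mul_le_mul_right this hpos
  · have h2 : specRad G ^ 2 * x u = ∑ w ∈ nb G u, ∑ z ∈ nb G w, x z := by
      simp only [hx]
      rw [← Finset.mul_sum, hx u]; ring
    have h3 : ∑ w ∈ nb G u, ∑ z ∈ nb G w, x z ≤ ∑ w ∈ nb G u, ((nb G w).card : ℝ) * x u :=
      Finset.sum_le_sum fun w _ => hb w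
    rw [← Finset.sum_mul, ← h2] at h3
    push_cast
    exact le_of_mul_le_mul_right h3 hpos

lemma weak_edges {n r : ℕ} (hn : 0 < n) {G : SimpleGraph (Fin n)} (hG : BookFree r G) :
    2 * specRad G ^ 2 ≤ 2 * (G.edgeSet.ncard : ℝ) + r * n := by
  obtain ⟨u, -, h⟩ := exists_max_vertex hn G
  have h1 := two_sum_nb_le G u
  have h2 : ∑ w ∈ nb G u, (nb G w ∩ nb G u).card ≤ r * n := by
    calc _ ≤ ∑ w ∈ nb G u, r := Finset.sum_le_sum fun w hw =>
          book_nb hG ((mem_nb G u w).1 hw).symm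
      _ = (nb G u).card * r := by simp
      _ ≤ n * r := Nat.mul_le_mul_right _ (card_nb_le G u)
      _ = r * n := mul_comm _ _
  have h3 : 2 * ∑ w ∈ nb G u, (nb G w).card ≤ 2 * G.edgeSet.ncard + r * n := by omega
  have h4 : 2 * ((∑ w ∈ nb G u, (nb G w).card : ℕ) : ℝ) ≤ 2 * (G.edgeSet.ncard : ℝ) + r * n := by
    exact_mod_cast h3
  linarith

/-! ### The colouring -/

lemma card_add_le {n r : ℕ} {G : SimpleGraph (Fin n)} (hG : BookFree r G) {u v : Fin n}
    (huv : G.Adj u v) : (nb G u).card + (nb G v).card ≤ n + r := by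
  rw [← Finset.card_union_add_card_inter]
  have h1 := book_nb hG huv
  have h2 : (nb G u ∪ nb G v).card ≤ n := by simpa using Finset.card_le_univ (nb G u ∪ nb G v)
  omega

lemma sum_sq_le {n r : ℕ} {G : SimpleGraph (Fin n)} (hG : BookFree r G) :
    ∑ v, (nb G v).card ^ 2 ≤ G.edgeSet.ncard * (n + r) := by
  have h1 : ∑ v, ∑ u ∈ nb G v, ((nb G v).card + (nb G u).card) = 2 * ∑ v, (nb G v).card ^ 2 := by
    simp only [Finset.sum_add_distrib]
    have e := sum_nb_comm G Finset.univ Finset.univ (fun _ j => (nb G j).card)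
    simp only [Finset.inter_univ] at e
    rw [e]
    simp only [Finset.sum_const, smul_eq_mul, ← pow_two]
    ring
  have h2 : ∑ v, ∑ u ∈ nb G v, ((nb G v).card + (nb G u).card) ≤ ∑ v, ∑ u ∈ nb G v, (n + r) :=
    Finset.sum_le_sum fun v _ => Finset.sum_le_sum fun u hu => card_add_le hG ((mem_nb G v u).1 hu)
  simp only [Finset.sum_const, smul_eq_mul, ← Finset.sum_mul] at h2
  rw [sum_nb_eq] at h2
  nlinarith

lemma variance_le {n r : ℕ} {G : SimpleGraph (Fin n)} (hG : BookFree r G) (hrn : r ≤ n)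
    (he : (n : ℝ) ^ 2 / 4 - (r + 1) * n ≤ G.edgeSet.ncard) :
    ∑ v, (((nb G v).card : ℝ) - n / 2) ^ 2 ≤ (2 * (r : ℝ) + 1) * (n : ℝ) ^ 2 := by
  have h1 : ∑ v, ((nb G v).card : ℝ) ^ 2 ≤ (G.edgeSet.ncard : ℝ) * (n + r) := by
    exact_mod_cast sum_sq_le hG
  have h2 : ∑ v, ((nb G v).card : ℝ) = 2 * (G.edgeSet.ncard : ℝ) := by
    exact_mod_cast sum_nb_eq G
  have h3 : ∑ v, (((nb G v).card : ℝ) - n / 2) ^ 2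
      = ∑ v, ((nb G v).card : ℝ) ^ 2 - n * ∑ v, ((nb G v).card : ℝ) + n * (n / 2) ^ 2 := by
    rw [Finset.mul_sum, ← Finset.sum_sub_distrib]
    have : (n : ℝ) * (n / 2) ^ 2 = ∑ v : Fin n, ((n : ℝ) / 2) ^ 2 := by simp
    rw [this, ← Finset.sum_add_distrib]
    exact Finset.sum_congr rfl fun v _ => by ring
  rw [h3, h2]
  have hrn' : (r : ℝ) ≤ n := by exact_mod_cast hrn
  have hr0 : (0 : ℝ) ≤ r := by positivity
  have hn0 : (0 : ℝ) ≤ n := by positivity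
  have h4 : ((n : ℝ) ^ 2 / 4 - (r + 1) * n) * (n - r) ≤ (G.edgeSet.ncard : ℝ) * (n - r) :=
    mul_le_mul_of_nonneg_right he (by linarith)
  nlinarith [mul_nonneg (mul_nonneg hr0 hn0) hn0, mul_nonneg (mul_nonneg hr0 hn0) hr0, mul_nonneg hr0 hn0]

lemma card_inter3 {n : ℕ} (X Y Z : Finset (Fin n)) :
    (X ∩ Z).card + (Y ∩ Z).card ≤ (X ∩ Y).card + Z.card := by
  rw [← Finset.card_union_add_card_inter]
  have h1 : ((X ∩ Z) ∪ (Y ∩ Z)).card ≤ Z.card :=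
    Finset.card_le_card (Finset.union_subset Finset.inter_subset_right Finset.inter_subset_right)
  have h2 : ((X ∩ Z) ∩ (Y ∩ Z)).card ≤ (X ∩ Y).card :=
    Finset.card_le_card (Finset.inter_subset_inter Finset.inter_subset_left Finset.inter_subset_left)
  omega

open Classical in
/-- Low degree vertices. -/
noncomputable def lowV {n : ℕ} (G : SimpleGraph (Fin n)) (t : ℝ) : Finset (Fin n) :=
  Finset.univ.filter (fun v => ((nb G v).card : ℝ) ≤ t * n)

lemma mem_lowV {n : ℕ} (G : SimpleGraph (Fin n)) (t : ℝ) (v : Fin n) :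
    v ∈ lowV G t ↔ ((nb G v).card : ℝ) ≤ t * n := by simp [lowV]

lemma lowV_card {n r : ℕ} {G : SimpleGraph (Fin n)} (hG : BookFree r G) (hrn : r ≤ n) (hn : 0 < n)
    (he : (n : ℝ) ^ 2 / 4 - (r + 1) * n ≤ G.edgeSet.ncard) :
    (lowV G 0.495).card ≤ 40000 * (2 * r + 1) := by
  have h1 := variance_le hG hrn he
  have h2 : ∑ v ∈ lowV G 0.495, ((n : ℝ) / 200) ^ 2 ≤ ∑ v, (((nb G v).card : ℝ) - n / 2) ^ 2 := by
    calc _ ≤ ∑ v ∈ lowV G 0.495, (((nb G v).card : ℝ) - n / 2) ^ 2 := by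
          apply Finset.sum_le_sum
          intro v hv
          rw [mem_lowV] at hv
          have hn0 : (0 : ℝ) ≤ n := by positivity
          nlinarith
      _ ≤ _ := Finset.sum_le_sum_of_subset_of_nonneg (Finset.subset_univ _)
          fun i _ _ => sq_nonneg _
  rw [Finset.sum_const, nsmul_eq_mul] at h2
  have hn0 : (0 : ℝ) < n := by exact_mod_cast hn
  have h3 : ((lowV G 0.495).card : ℝ) * n ^ 2 ≤ (40000 * (2 * r + 1)) * n ^ 2 := by nlinarith
  have h4 := le_of_mul_le_mul_right h3 (by positivity)
  exact_mod_cast h4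

/-- The structural colouring: monochromatic edges have small degree sum. -/
lemma coloring_exists {n r : ℕ} {G : SimpleGraph (Fin n)} (hG : BookFree r G)
    (hn : 40000 * 1000 * (2 * r + 1) ≤ n)
    (he : (n : ℝ) ^ 2 / 4 - (r + 1) * n ≤ G.edgeSet.ncard) :
    ∃ c : Fin n → Bool, ∀ u v, G.Adj u v → c u = c v →
      ((nb G u).card : ℝ) + (nb G v).card ≤ 0.54 * n := by
  classical
  have hS := lowV_card hG (by omega) (by omega) he
  set S := lowV G 0.495 with hSdef
  have hnR : (40000 * 1000 * (2 * r + 1) : ℝ) ≤ n := by exact_mod_cast hn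
  have hSR : (S.card : ℝ) ≤ 40000 * (2 * r + 1) := by exact_mod_cast hS
  have hr0 : (0 : ℝ) ≤ r := by positivity
  have hhigh : ∀ v, v ∉ S → 0.495 * (n : ℝ) ≤ (nb G v).card := by
    intro v hv
    rw [hSdef, mem_lowV] at hv
    linarith
  obtain ⟨u, hu⟩ : ∃ u, u ∉ S := by
    by_contra! h
    have : S = Finset.univ := Finset.eq_univ_iff_forall.2 h
    rw [this] at hS
    simp at hS
    omega
  have hdu := hhigh u hu
  obtain ⟨v, hv, hvS⟩ : ∃ v ∈ nb G u, v ∉ S := by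
    apply Finset.exists_mem_notMem_of_card_lt_card
    have : (S.card : ℝ) < (nb G u).card := by linarith
    exact_mod_cast this
  have hdv := hhigh v hvS
  have huv : ((nb G u).card : ℝ) + (nb G v).card ≤ n + r := by
    exact_mod_cast card_add_le hG ((mem_nb G u v).1 hv)
  have hduU : ((nb G u).card : ℝ) ≤ 0.505 * n + r := by linarith
  -- the two colours
  have hc1 : ∀ w, (∃ x, x ∉ S ∧ x ∈ nb G u ∧ x ∈ nb G w) →
      ((nb G w ∩ (nb G u)ᶜ).card : ℝ) ≤ 0.01 * n + 2 * r := by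
    rintro w ⟨x, hxS, hxu, hxw⟩
    have h1 := book_nb hG ((mem_nb G u x).1 hxu)
    have h2 := book_nb hG ((mem_nb G w x).1 hxw)
    have h3 : (nb G w ∩ (nb G u)ᶜ).card ≤ ((nb G u ∪ nb G x)ᶜ).card + (nb G w ∩ nb G x).card := by
      refine le_trans (Finset.card_le_card ?_) (Finset.card_union_le _ _)
      intro y hy
      simp only [Finset.mem_inter, Finset.mem_union, Finset.mem_compl] at hy ⊢
      tauto
    have h4 : (nb G u ∪ nb G x).card + ((nb G u ∪ nb G x)ᶜ).card = n := by
      rw [Finset.card_add_card_compl]; simp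
    have h5 := Finset.card_union_add_card_inter (nb G u) (nb G x)
    have h6 := hhigh x hxS
    have h7 : (nb G w ∩ (nb G u)ᶜ).card + (nb G u).card + (nb G x).card ≤ n + 2 * r := by omega
    have h8 : ((nb G w ∩ (nb G u)ᶜ).card : ℝ) + (nb G u).card + (nb G x).card ≤ n + 2 * r := by
      exact_mod_cast h7
    linarith
  have hc2 : ∀ w, ¬ (∃ x, x ∉ S ∧ x ∈ nb G u ∧ x ∈ nb G w) → (nb G w ∩ nb G u).card ≤ S.card := by
    intro w hw
    apply Finset.card_le_card
    intro x hx
    by_contra hxS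
    rw [Finset.mem_inter] at hx
    exact hw ⟨x, hxS, hx.2, hx.1⟩
  refine ⟨fun w => decide (∃ x, x ∉ S ∧ x ∈ nb G u ∧ x ∈ nb G w), ?_⟩
  intro w w' hww hc
  have hb : ((nb G w ∩ nb G w').card : ℝ) ≤ r := by exact_mod_cast book_nb hG hww
  have s1 : ((nb G w).card : ℝ) = (nb G w ∩ nb G u).card + (nb G w ∩ (nb G u)ᶜ).card := by
    exact_mod_cast card_split _ _
  have s2 : ((nb G w').card : ℝ) = (nb G w' ∩ nb G u).card + (nb G w' ∩ (nb G u)ᶜ).card := by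
    exact_mod_cast card_split _ _
  rw [decide_eq_decide] at hc
  by_cases hw : ∃ x, x ∉ S ∧ x ∈ nb G u ∧ x ∈ nb G w
  · have a1 := hc1 w hw
    have a2 := hc1 w' (hc.1 hw)
    have a3 : ((nb G w ∩ nb G u).card : ℝ) + (nb G w' ∩ nb G u).card
      ≤ (nb G w ∩ nb G w').card + (nb G u).card := by exact_mod_cast card_inter3 _ _ _
    linarith
  · have a1 : ((nb G w ∩ nb G u).card : ℝ) ≤ S.card := by exact_mod_cast hc2 w hw
    have a2 : ((nb G w' ∩ nb G u).card : ℝ) ≤ S.card := by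
      exact_mod_cast hc2 w' (fun h => hw (hc.2 h))
    have a3 : ((nb G w ∩ (nb G u)ᶜ).card : ℝ) + (nb G w' ∩ (nb G u)ᶜ).card
      ≤ (nb G w ∩ nb G w').card + ((nb G u)ᶜ).card := by exact_mod_cast card_inter3 _ _ _
    have a4 : ((nb G u).card : ℝ) + ((nb G u)ᶜ).card = n := by
      have : (nb G u).card + ((nb G u)ᶜ).card = n := by
        rw [Finset.card_add_card_compl]; simp
      exact_mod_cast this
    linarith

/-! ### Removing one vertex -/

lemma strong_edges {n r : ℕ} (hn : 0 < n) {G : SimpleGraph (Fin n)} (hG : BookFree r G)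
    (c : Fin n → Bool) (hc : ∀ u v, G.Adj u v → c u = c v →
      ((nb G u).card : ℝ) + (nb G v).card ≤ 0.54 * n)
    (hs : 0.49 * (n : ℝ) ≤ specRad G) :
    specRad G ^ 2 ≤ (G.edgeSet.ncard : ℝ) + r * (lowV G 0.3).card := by
  obtain ⟨u, hu, h⟩ := exists_max_vertex hn G
  have h1 := two_sum_nb_le G u
  set Q := lowV G 0.3 with hQ
  set N := nb G u with hN
  have hn0 : (0 : ℝ) < n := by exact_mod_cast hn
  have hd : ∀ y, y ∉ Q → 0.3 * (n : ℝ) < (nb G y).card := by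
    intro y hy
    rw [hQ, mem_lowV] at hy
    exact not_le.1 hy
  have hsame : ∀ y ∈ N, c y = c u → y ∈ Q := by
    intro y hy hyu
    by_contra hyQ
    have := hc u y ((mem_nb G u y).1 hy) hyu.symm
    have := hd y hyQ
    linarith
  have key : ∀ y ∈ N, y ∉ Q → (nb G y ∩ N) ⊆ nb G y ∩ (N ∩ Q) := by
    intro y hy hyQ z hz
    simp only [Finset.mem_inter] at hz ⊢
    refine ⟨hz.1, hz.2, ?_⟩
    by_contra hzQ
    have hyz := (mem_nb G y z).1 hz.1
    have e1 : c y ≠ c u := fun e => hyQ (hsame y hy e)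
    have e2 : c z ≠ c u := fun e => hzQ (hsame z hz.2 e)
    have e3 : c y = c z := by
      cases h1 : c y <;> cases h2 : c z <;> cases h3 : c u <;> simp_all
    have := hc y z hyz e3
    have := hd y hyQ
    have := hd z hzQ
    linarith
  have hbk : ∑ w ∈ N ∩ Q, (nb G w ∩ N).card ≤ r * Q.card := by
    calc _ ≤ ∑ w ∈ N ∩ Q, r := Finset.sum_le_sum fun w hw =>
          book_nb hG ((mem_nb G u w).1 (Finset.mem_inter.1 hw).1).symm
      _ = (N ∩ Q).card * r := by simp
      _ ≤ Q.card * r := Nat.mul_le_mul_right _ (Finset.card_le_card Finset.inter_subset_right)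
      _ = r * Q.card := mul_comm _ _
  have h2 : ∑ w ∈ N, (nb G w ∩ N).card ≤ 2 * (r * Q.card) := by
    have e1 : ∑ w ∈ N, (nb G w ∩ N).card
        = ∑ w ∈ N ∩ Q, (nb G w ∩ N).card + ∑ w ∈ N \ Q, (nb G w ∩ N).card :=
      (Finset.sum_inter_add_sum_sdiff N Q _).symm
    have e2 : ∑ w ∈ N \ Q, (nb G w ∩ N).card ≤ ∑ w ∈ N \ Q, (nb G w ∩ (N ∩ Q)).card :=
      Finset.sum_le_sum fun w hw => Finset.card_le_card
        (key w (Finset.mem_sdiff.1 hw).1 (Finset.mem_sdiff.1 hw).2)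
    have e3 : ∑ w ∈ N \ Q, (nb G w ∩ (N ∩ Q)).card ≤ ∑ w ∈ N, (nb G w ∩ (N ∩ Q)).card :=
      Finset.sum_le_sum_of_subset Finset.sdiff_subset
    have e4 := card_nb_comm G N (N ∩ Q)
    omega
  have h3 : ∑ w ∈ N, (nb G w).card ≤ G.edgeSet.ncard + r * Q.card := by omega
  have h4 : ((∑ w ∈ N, (nb G w).card : ℕ) : ℝ) ≤ (G.edgeSet.ncard : ℝ) + r * Q.card := by
    exact_mod_cast h3
  linarith

lemma cut_bound {n : ℕ} (G : SimpleGraph (Fin n)) (c : Fin n → Bool) (Q : Finset (Fin n))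
    (hc : ∀ u v, u ∉ Q → v ∉ Q → G.Adj u v → c u ≠ c v) :
    (G.edgeSet.ncard : ℝ) ≤ ∑ v ∈ Q, ((nb G v).card : ℝ) + ((n : ℝ) - Q.card) ^ 2 / 4 := by
  classical
  set A := Qᶜ.filter (fun v => c v = true) with hA
  set B := Qᶜ.filter (fun v => ¬ c v = true) with hB
  have hAB : A.card + B.card + Q.card = n := by
    rw [Finset.card_filter_add_card_filter_not, add_comm, Finset.card_add_card_compl]; simp
  have h1 : ∑ v ∈ Qᶜ, (nb G v).card
      = ∑ v ∈ Qᶜ, (nb G v ∩ Q).card + ∑ v ∈ Qᶜ, (nb G v ∩ Qᶜ).card := by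
    rw [← Finset.sum_add_distrib]
    exact Finset.sum_congr rfl fun w _ => card_split _ _
  have h2 : ∑ v ∈ Qᶜ, (nb G v ∩ Q).card ≤ ∑ v ∈ Q, (nb G v).card := by
    rw [card_nb_comm]
    exact Finset.sum_le_sum fun w _ => Finset.card_le_card Finset.inter_subset_left
  have h3 : ∑ v ∈ Qᶜ, (nb G v ∩ Qᶜ).card ≤ A.card * B.card + B.card * A.card := by
    rw [← Finset.sum_filter_add_sum_filter_not Qᶜ (fun v => c v = true)]
    apply add_le_add
    · rw [← smul_eq_mul, ← Finset.sum_const]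
      apply Finset.sum_le_sum
      intro v hv
      apply Finset.card_le_card
      intro z hz
      simp only [Finset.mem_inter, mem_nb, Finset.mem_filter, Finset.mem_compl, hB] at hv hz ⊢
      refine ⟨hz.2, fun h => hc v z hv.1 hz.2 hz.1 (by rw [hv.2, h])⟩
    · rw [← smul_eq_mul, ← Finset.sum_const]
      apply Finset.sum_le_sum
      intro v hv
      apply Finset.card_le_card
      intro z hz
      simp only [Finset.mem_inter, mem_nb, Finset.mem_filter, Finset.mem_compl, hA] at hv hz ⊢
      refine ⟨hz.2, ?_⟩
      have := hc v z hv.1 hz.2 hz.1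
      cases h1 : c v <;> cases h2 : c z <;> simp_all
  have h4 := sum_nb_eq G
  rw [← Finset.sum_add_sum_compl Q] at h4
  have h5 : G.edgeSet.ncard ≤ ∑ v ∈ Q, (nb G v).card + A.card * B.card := by nlinarith
  have h6 : (G.edgeSet.ncard : ℝ) ≤ ∑ v ∈ Q, ((nb G v).card : ℝ) + A.card * B.card := by
    exact_mod_cast h5
  have h7 : (n : ℝ) - Q.card = A.card + B.card := by
    have : (A.card : ℝ) + B.card + Q.card = n := by exact_mod_cast hAB
    linarith
  rw [h7]
  nlinarith [sq_nonneg ((A.card : ℝ) - B.card)]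

lemma not_colorable_ex {n : ℕ} {G : SimpleGraph (Fin n)} (h : ¬ G.Colorable 2) (c : Fin n → Bool) :
    ∃ u v, G.Adj u v ∧ c u = c v := by
  by_contra! hc
  exact h ⟨⟨fun v => if c v then 0 else 1, fun {u v} huv => by
    have := hc u v huv
    cases h1 : c u <;> cases h2 : c v <;> simp_all⟩⟩

lemma one_vertex {n r : ℕ} {G : SimpleGraph (Fin n)}
    (hnb : ¬ G.Colorable 2) (hn : 100000000 * (r + 1) ^ 2 ≤ n)
    (c : Fin n → Bool) (hc : ∀ u v, G.Adj u v → c u = c v →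
      ((nb G u).card : ℝ) + (nb G v).card ≤ 0.54 * n)
    (hQ : (lowV G 0.3).card ≤ 80000 * (r + 1))
    (he : (n : ℝ) ^ 2 / 4 - n / 2 - 80000 * (r + 1) ^ 2 ≤ G.edgeSet.ncard) :
    ∃ w, ((nb G w).card : ℝ) ≤ 0.3 * n ∧ ∀ u v, u ≠ w → v ≠ w → G.Adj u v → c u ≠ c v := by
  set Q := lowV G 0.3 with hQd
  have hnR : 100000000 * ((r : ℝ) + 1) ^ 2 ≤ n := by exact_mod_cast hn
  have hr0 : (0 : ℝ) ≤ r := by positivity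
  have hrr : ((r : ℝ) + 1) ≤ (r + 1) ^ 2 := by nlinarith
  have hn0 : (0 : ℝ) ≤ n := by positivity
  have hd : ∀ y, y ∉ Q → 0.3 * (n : ℝ) < (nb G y).card := by
    intro y hy
    rw [hQd, mem_lowV] at hy
    exact not_le.1 hy
  have hprop : ∀ u v, u ∉ Q → v ∉ Q → G.Adj u v → c u ≠ c v := by
    intro u v hu hv huv h
    have := hc u v huv h
    have := hd u hu
    have := hd v hv
    linarith
  have hcut := cut_bound G c Q hprop
  have hQR : (Q.card : ℝ) ≤ 80000 * (r + 1) := by exact_mod_cast hQ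
  have hsum : ∑ v ∈ Q, ((nb G v).card : ℝ) ≤ Q.card * (0.3 * n) := by
    rw [← nsmul_eq_mul, ← Finset.sum_const]
    exact Finset.sum_le_sum fun v hv => (mem_lowV G _ v).1 hv
  have hk : Q.card ≤ 2 := by
    by_contra! h3
    have h3R : (3 : ℝ) ≤ Q.card := by exact_mod_cast h3
    have b1 : (Q.card : ℝ) * Q.card ≤ Q.card * (80000 * (r + 1)) :=
      mul_le_mul_of_nonneg_left hQR (by positivity)
    have b2 : (Q.card : ℝ) * (80000 * (r + 1)) ≤ Q.card * (0.001 * n) :=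
      mul_le_mul_of_nonneg_left (by linarith) (by positivity)
    have b3 : 3 * (n : ℝ) ≤ Q.card * n := mul_le_mul_of_nonneg_right h3R hn0
    have hrp : (0 : ℝ) < (r + 1) ^ 2 := by positivity
    nlinarith
  obtain ⟨u0, v0, huv0, hcuv0⟩ := not_colorable_ex hnb c
  interval_cases hkc : Q.card
  · rw [Finset.card_eq_zero] at hkc
    exact absurd hcuv0 (hprop u0 v0 (by simp [hkc]) (by simp [hkc]) huv0)
  · obtain ⟨w, hw⟩ := Finset.card_eq_one.1 hkc
    refine ⟨w, (mem_lowV G _ w).1 (by rw [← hQd, hw]; simp), ?_⟩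
    intro u v hu hv
    exact hprop u v (by simpa [hw] using hu) (by simpa [hw] using hv)
  · -- choose the vertex of smaller degree
    obtain ⟨p, q, hpq, hQpq, hle⟩ : ∃ p q, p ≠ q ∧ Q = {p, q} ∧ (nb G p).card ≤ (nb G q).card := by
      obtain ⟨p, q, hpq, h⟩ := Finset.card_eq_two.1 hkc
      rcases le_total (nb G p).card (nb G q).card with h' | h'
      · exact ⟨p, q, hpq, h, h'⟩
      · exact ⟨q, p, hpq.symm, by rw [h, Finset.pair_comm], h'⟩
    refine ⟨p, (mem_lowV G _ p).1 (by rw [← hQd, hQpq]; simp), ?_⟩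
    have hleR : ((nb G p).card : ℝ) ≤ (nb G q).card := by exact_mod_cast hle
    have hsum2 : ∑ v ∈ Q, ((nb G v).card : ℝ) = (nb G p).card + (nb G q).card := by
      rw [hQpq, Finset.sum_pair hpq]
    have hqbig : 0.24 * (n : ℝ) < (nb G q).card := by
      by_contra! hq
      rw [hsum2] at hcut
      norm_num at hcut
      have hrp : (1 : ℝ) ≤ (r + 1) ^ 2 := by nlinarith
      nlinarith
    have aux : ∀ v, v ≠ p → G.Adj q v → c q ≠ c v := by
      intro v hvp hqv h
      have hvQ : v ∉ Q := by
        rw [hQpq]; simp [hvp, hqv.ne']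
      have := hc q v hqv h
      have := hd v hvQ
      linarith
    intro u v hu hv huv
    by_cases huq : u = q
    · subst huq; exact aux v hv huv
    by_cases hvq : v = q
    · subst hvq; exact (aux u hu huv.symm).symm
    exact hprop u v (by rw [hQpq]; simp [hu, huq]) (by rw [hQpq]; simp [hv, hvq]) huv

/-! ### Counting edges when one vertex deletion gives a bipartite graph -/

/-- Colour class of `b` with the vertex `w` removed. -/
def part {n : ℕ} (c : Fin n → Bool) (w : Fin n) (b : Bool) : Finset (Fin n) :=
  Finset.univ.filter (fun v => v ≠ w ∧ c v = b)

lemma mem_part {n : ℕ} (c : Fin n → Bool) (w : Fin n) (b : Bool) (v : Fin n) :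
    v ∈ part c w b ↔ v ≠ w ∧ c v = b := by simp [part]

/-- Number of edges between the two classes. -/
noncomputable def mid {n : ℕ} (G : SimpleGraph (Fin n)) (c : Fin n → Bool) (w : Fin n)
    (b : Bool) : ℕ := ∑ v ∈ part c w b, (nb G v ∩ part c w (!b)).card

lemma mid_comm {n : ℕ} (G : SimpleGraph (Fin n)) (c : Fin n → Bool) (w : Fin n)
    (b : Bool) : mid G c w b = mid G c w (!b) := by
  unfold mid
  rw [card_nb_comm, Bool.not_not]

lemma part_disj {n : ℕ} (c : Fin n → Bool) (w : Fin n) (b : Bool) :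
    Disjoint (part c w b) (part c w (!b)) := by
  rw [Finset.disjoint_left]
  intro v h1 h2
  rw [mem_part] at h1 h2
  rw [h1.2] at h2
  simp at h2

lemma part_univ {n : ℕ} (c : Fin n → Bool) (w : Fin n) (b : Bool) :
    (Finset.univ : Finset (Fin n)) = insert w (part c w b ∪ part c w (!b)) := by
  ext v
  simp only [Finset.mem_univ, Finset.mem_insert, Finset.mem_union, mem_part, true_iff]
  by_cases h : v = w
  · exact Or.inl h
  · right
    cases b <;> cases h1 : c v <;> simp [h]

lemma part_w {n : ℕ} (c : Fin n → Bool) (w : Fin n) (b : Bool) :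
    w ∉ part c w b ∪ part c w (!b) := by
  simp [mem_part]

lemma part_sum {n : ℕ} {R : Type*} [AddCommMonoid R] (c : Fin n → Bool) (w : Fin n) (b : Bool)
    (f : Fin n → R) :
    ∑ v, f v = f w + (∑ v ∈ part c w b, f v + ∑ v ∈ part c w (!b), f v) := by
  rw [part_univ c w b, Finset.sum_insert (part_w c w b), Finset.sum_union (part_disj c w b)]

lemma part_card {n : ℕ} (c : Fin n → Bool) (w : Fin n) (b : Bool) :
    (part c w b).card + (part c w (!b)).card + 1 = n := by
  have := part_sum c w b (fun _ => 1)
  simp at this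
  omega

lemma nb_w_split {n : ℕ} (G : SimpleGraph (Fin n)) (c : Fin n → Bool) (w : Fin n) (b : Bool) :
    nb G w = (nb G w ∩ part c w b) ∪ (nb G w ∩ part c w (!b)) := by
  ext v
  simp only [Finset.mem_union, Finset.mem_inter, mem_nb, mem_part]
  constructor
  · intro h
    have := h.ne'
    cases b <;> cases h1 : c v <;> simp [h, this]
  · tauto

lemma nb_w_disj {n : ℕ} (G : SimpleGraph (Fin n)) (c : Fin n → Bool) (w : Fin n) (b : Bool) :
    Disjoint (nb G w ∩ part c w b) (nb G w ∩ part c w (!b)) :=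
  Finset.disjoint_of_subset_left Finset.inter_subset_right
    (Finset.disjoint_of_subset_right Finset.inter_subset_right (part_disj c w b))

lemma nb_w_card {n : ℕ} (G : SimpleGraph (Fin n)) (c : Fin n → Bool) (w : Fin n) (b : Bool) :
    (nb G w).card = (nb G w ∩ part c w b).card + (nb G w ∩ part c w (!b)).card := by
  conv_lhs => rw [nb_w_split G c w b]
  exact Finset.card_union_of_disjoint (nb_w_disj G c w b)

lemma nb_part_subset {n : ℕ} {G : SimpleGraph (Fin n)} {c : Fin n → Bool} {w : Fin n}
    (hp : ∀ u v, u ≠ w → v ≠ w → G.Adj u v → c u ≠ c v) {b : Bool} {v : Fin n}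
    (hv : v ∈ part c w b) : nb G v = (nb G v ∩ part c w (!b)) ∪ (nb G v ∩ {w}) := by
  ext z
  simp only [Finset.mem_union, Finset.mem_inter, mem_nb, mem_part, Finset.mem_singleton] at hv ⊢
  constructor
  · intro h
    by_cases hz : z = w
    · exact Or.inr ⟨h, hz⟩
    · refine Or.inl ⟨h, hz, ?_⟩
      have := hp v z hv.1 hz h
      rw [hv.2] at this
      cases b <;> cases h1 : c z <;> simp_all
  · tauto

lemma nb_part_card {n : ℕ} {G : SimpleGraph (Fin n)} {c : Fin n → Bool} {w : Fin n}
    (hp : ∀ u v, u ≠ w → v ≠ w → G.Adj u v → c u ≠ c v) {b : Bool} {v : Fin n}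
    (hv : v ∈ part c w b) :
    (nb G v).card = (nb G v ∩ part c w (!b)).card + (nb G v ∩ {w}).card := by
  conv_lhs => rw [nb_part_subset hp hv]
  apply Finset.card_union_of_disjoint
  rw [Finset.disjoint_left]
  intro z h1 h2
  simp [mem_part] at h1 h2
  exact h1.2.1 h2.2

lemma sum_part_deg {n : ℕ} {G : SimpleGraph (Fin n)} {c : Fin n → Bool} {w : Fin n}
    (hp : ∀ u v, u ≠ w → v ≠ w → G.Adj u v → c u ≠ c v) (b : Bool) :
    ∑ v ∈ part c w b, (nb G v).card = mid G c w b + (nb G w ∩ part c w b).card := by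
  have e := card_nb_comm G (part c w b) {w}
  simp only [Finset.sum_singleton] at e
  rw [← e, mid, ← Finset.sum_add_distrib]
  exact Finset.sum_congr rfl fun v hv => nb_part_card hp hv

lemma edges_eq {n : ℕ} {G : SimpleGraph (Fin n)} {c : Fin n → Bool} {w : Fin n}
    (hp : ∀ u v, u ≠ w → v ≠ w → G.Adj u v → c u ≠ c v) (b : Bool) :
    G.edgeSet.ncard = mid G c w b + (nb G w).card := by
  have h := sum_nb_eq G
  rw [part_sum c w b, sum_part_deg hp, sum_part_deg hp, ← mid_comm] at h
  have := nb_w_card G c w b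
  omega

lemma nb_w_nonempty {n : ℕ} {G : SimpleGraph (Fin n)} {c : Fin n → Bool} {w : Fin n}
    (hnb : ¬ G.Colorable 2)
    (hp : ∀ u v, u ≠ w → v ≠ w → G.Adj u v → c u ≠ c v) (b : Bool) :
    (nb G w ∩ part c w b).Nonempty := by
  classical
  by_contra h
  rw [Finset.not_nonempty_iff_eq_empty] at h
  have hw : ∀ v, G.Adj w v → c v ≠ b := by
    intro v hv hb
    have : v ∈ nb G w ∩ part c w b := by
      simp [mem_nb, mem_part, hv, hv.ne', hb]
    rw [h] at this
    simp at this
  obtain ⟨u, v, huv, he⟩ := not_colorable_ex hnb (fun v => if v = w then b else c v)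
  by_cases hu : u = w
  · subst hu
    simp [huv.ne'] at he
    exact hw v huv he.symm
  by_cases hv : v = w
  · subst hv
    simp [hu] at he
    exact hw u huv.symm he
  simp [hu, hv] at he
  exact hp u v hu hv huv he

lemma mid_le {n : ℕ} (G : SimpleGraph (Fin n)) (c : Fin n → Bool) (w : Fin n) (b : Bool) :
    mid G c w b ≤ (part c w b).card * (part c w (!b)).card := by
  unfold mid
  rw [← smul_eq_mul, ← Finset.sum_const]
  exact Finset.sum_le_sum fun v _ => Finset.card_le_card Finset.inter_subset_right

lemma mid_le' {n r : ℕ} {G : SimpleGraph (Fin n)} (hG : BookFree r G)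
    (c : Fin n → Bool) (w : Fin n) (b : Bool) :
    mid G c w b + (nb G w ∩ part c w b).card * (nb G w ∩ part c w (!b)).card
      ≤ (part c w b).card * (part c w (!b)).card + (nb G w ∩ part c w b).card * r := by
  set A := part c w b
  set B := part c w (!b)
  have h1 : ∑ v ∈ A, ((nb G v ∩ B).card + if v ∈ nb G w then (nb G w ∩ B).card else 0)
      ≤ ∑ v ∈ A, (B.card + if v ∈ nb G w then r else 0) := by
    apply Finset.sum_le_sum
    intro v _
    by_cases hv : v ∈ nb G w
    · simp only [hv, if_true]
      have := card_inter3 (nb G v) (nb G w) B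
      have := book_nb hG ((mem_nb G w v).1 hv).symm
      omega
    · simp only [hv, if_false, add_zero]
      exact Finset.card_le_card Finset.inter_subset_right
  rw [Finset.sum_add_distrib, Finset.sum_add_distrib, ← Finset.sum_filter, ← Finset.sum_filter] at h1
  have e : A.filter (fun v => v ∈ nb G w) = nb G w ∩ A := by
    ext v; simp [and_comm]
  rw [e] at h1
  simpa [mid] using h1

lemma arith_key {r s t m P : ℕ} (hr : 1 ≤ r) (hs : 1 ≤ s) (ht : 1 ≤ t) (h0 : m ≤ P)
    (h1 : m + s * t ≤ P + s * r) (h2 : m + t * s ≤ P + t * r) : m + (s + t) ≤ P + 2 * r := by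
  by_cases ha : r < t
  · obtain ⟨k, rfl⟩ := Nat.exists_eq_add_of_lt ha
    obtain ⟨j, rfl⟩ := Nat.exists_eq_add_of_le hs
    nlinarith [Nat.zero_le (j * k)]
  · by_cases hb : r < s
    · obtain ⟨k, rfl⟩ := Nat.exists_eq_add_of_lt hb
      obtain ⟨j, rfl⟩ := Nat.exists_eq_add_of_le ht
      nlinarith [Nat.zero_le (j * k)]
    · omega

lemma mid_add_deg_le {n r : ℕ} (hr : 1 ≤ r) {G : SimpleGraph (Fin n)} (hG : BookFree r G)
    (hnb : ¬ G.Colorable 2) {c : Fin n → Bool} {w : Fin n}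
    (hp : ∀ u v, u ≠ w → v ≠ w → G.Adj u v → c u ≠ c v) (b : Bool) :
    mid G c w b + (nb G w).card ≤ (part c w b).card * (part c w (!b)).card + 2 * r := by
  rw [nb_w_card G c w b]
  apply arith_key hr (nb_w_nonempty hnb hp b).card_pos (nb_w_nonempty hnb hp (!b)).card_pos
    (mid_le G c w b) (mid_le' hG c w b)
  have := mid_le' hG c w (!b)
  rw [← mid_comm, Bool.not_not] at this
  rw [mul_comm (part c w b).card]
  exact this

lemma prod_le {a b n : ℕ} (h : a + b + 1 = n) : a * b ≤ ((n - 1) / 2) * (n / 2) := by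
  have e : n - 1 = a + b := by omega
  rcases Nat.even_or_odd' (a + b) with ⟨k, hk | hk⟩
  · have h1 : (n - 1) / 2 = k := by omega
    have h2 : n / 2 = k := by omega
    rw [h1, h2]
    zify at hk ⊢
    nlinarith [sq_nonneg ((a : ℤ) - b)]
  · have h1 : (n - 1) / 2 = k := by omega
    have h2 : n / 2 = k + 1 := by omega
    rw [h1, h2]
    zify at hk ⊢
    have h3 : (a : ℤ) - b ≤ -1 ∨ 1 ≤ (a : ℤ) - b := by omega
    have h4 : 1 ≤ ((a : ℤ) - b) ^ 2 := by rcases h3 with h3 | h3 <;> nlinarith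
    nlinarith

lemma edges_le {n r : ℕ} (hr : 1 ≤ r) {G : SimpleGraph (Fin n)} (hG : BookFree r G)
    (hnb : ¬ G.Colorable 2) {c : Fin n → Bool} {w : Fin n}
    (hp : ∀ u v, u ≠ w → v ≠ w → G.Adj u v → c u ≠ c v) :
    G.edgeSet.ncard ≤ ((n - 1) / 2) * (n / 2) + 2 * r := by
  rw [edges_eq hp true]
  have h1 := mid_add_deg_le hr hG hnb hp true
  have h2 := prod_le (part_card c w true)
  omega

/-! ### Spectral estimates when one vertex deletion gives a bipartite graph -/

lemma spec_ineqs {n : ℕ} (hn : 0 < n) {G : SimpleGraph (Fin n)} {c : Fin n → Bool} {w : Fin n}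
    (hp : ∀ u v, u ≠ w → v ≠ w → G.Adj u v → c u ≠ c v) (hρ : 0 < specRad G) (M : ℝ)
    (hM : ∀ b, ((part c w b).card : ℝ) ≤ M) :
    ∃ q : ℝ, 0 ≤ q ∧ q ≤ 1 ∧
      specRad G ^ 2 * (1 - 2 * q) ^ 2 ≤ mid G c w true * (1 - q) ^ 2 ∧
      specRad G ^ 2 * q ≤ (nb G w).card ∧
      specRad G ^ 2 * (specRad G ^ 2 * q) ≤ ((nb G w).card : ℝ) ^ 2 * ((M + 1) * (1 / 2 + q)) := by
  obtain ⟨⟨x, hx0, hx1, hx⟩, -⟩ := spec_exists hn G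
  set ρ := specRad G with hρd
  let al : Bool → ℝ := fun b => ∑ v ∈ part c w b, x v ^ 2
  let si : Bool → ℝ := fun b => ∑ v ∈ nb G w ∩ part c w b, x v
  let E : Bool → ℝ := fun b => ∑ v ∈ part c w b, ∑ z ∈ nb G v ∩ part c w (!b), x v * x z
  have hE : ∀ b, E b = E (!b) := by
    intro b
    simp only [E]
    rw [sum_nb_comm, Bool.not_not]
    exact Finset.sum_congr rfl fun i _ => Finset.sum_congr rfl fun j _ => mul_comm _ _
  have hal0 : ∀ b, 0 ≤ al b := fun b => Finset.sum_nonneg fun i _ => sq_nonneg _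
  have hsi0 : ∀ b, 0 ≤ si b := fun b => Finset.sum_nonneg fun i _ => hx0 i
  have htot : ∀ b, x w ^ 2 + (al b + al (!b)) = 1 := by
    intro b
    rw [← hx1, part_sum c w b (fun v => x v ^ 2)]
  have hsw : ∀ b, ρ * x w = si b + si (!b) := by
    intro b
    rw [← hx w, nb_w_split G c w b, Finset.sum_union (nb_w_disj G c w b)]
  have hbal : ∀ b, ρ * al b = E b + x w * si b := by
    intro b
    have h1 : ∀ v ∈ part c w b, ρ * x v ^ 2
        = ∑ z ∈ nb G v ∩ part c w (!b), x v * x z + ∑ z ∈ nb G v ∩ {w}, x v * x z := by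
      intro v hv
      have : ρ * x v ^ 2 = x v * (ρ * x v) := by ring
      rw [this, ← hx v, nb_part_subset hp hv, Finset.sum_union, mul_add, Finset.mul_sum,
        Finset.mul_sum, ← nb_part_subset hp hv]
      rw [Finset.disjoint_left]
      intro z h1 h2
      simp [mem_part] at h1 h2
      exact h1.2.1 h2.2
    simp only [al, E, si]
    rw [Finset.mul_sum, Finset.sum_congr rfl h1, Finset.sum_add_distrib,
      sum_nb_comm G (part c w b) {w}, Finset.sum_singleton, Finset.mul_sum]
    congr 1
    exact Finset.sum_congr rfl fun i _ => mul_comm _ _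
  have hhalf : ∀ b, al b ≤ 1 / 2 := by
    intro b
    have h1 := hbal b
    have h2 := hbal (!b)
    rw [← hE b] at h2
    have h3 := hsw b
    have h4 := htot b
    have h5 : 0 ≤ x w * si (!b) := mul_nonneg (hx0 w) (hsi0 _)
    have h6 : ρ * x w ^ 2 = x w * si b + x w * si (!b) := by
      rw [pow_two, ← mul_assoc, h3]; ring
    have h7 : ρ * al b ≤ ρ * (1 / 2) := by
      have : ρ * (x w ^ 2 + (al b + al (!b))) = ρ := by rw [h4, mul_one]
      nlinarith
    exact le_of_mul_le_mul_left h7 hρ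
  have hCS : E true ^ 2 ≤ mid G c w true * (al true * al false) := by
    have e1 : E true = ∑ p ∈ (part c w true).sigma (fun v => nb G v ∩ part c w false),
        x p.1 * x p.2 := by
      rw [Finset.sum_sigma]; rfl
    have e2 : ((part c w true).sigma (fun v => nb G v ∩ part c w false)).card = mid G c w true := by
      rw [Finset.card_sigma]; rfl
    rw [e1, ← e2]
    refine le_trans sq_sum_le_card_mul_sum_sq ?_
    apply mul_le_mul_of_nonneg_left _ (Nat.cast_nonneg _)
    rw [Finset.sum_sigma]
    simp only [al]
    rw [Finset.sum_mul_sum]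
    apply Finset.sum_le_sum
    intro v _
    simp only [mul_pow]
    exact Finset.sum_le_sum_of_subset_of_nonneg Finset.inter_subset_right
      fun i _ _ => by positivity
  have hent : ∀ b, ∀ v ∈ part c w b, ρ ^ 2 * x v ^ 2 ≤ (M + 1) * (1 / 2 + x w ^ 2) := by
    intro b v hv
    have h1 : (∑ z ∈ nb G v, x z) ^ 2 ≤ (nb G v).card * ∑ z ∈ nb G v, x z ^ 2 :=
      sq_sum_le_card_mul_sum_sq
    rw [hx v, mul_pow] at h1
    have hsub : nb G v ⊆ insert w (part c w (!b)) := by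
      rw [nb_part_subset hp hv]
      intro z hz
      simp only [Finset.mem_union, Finset.mem_inter, Finset.mem_singleton, Finset.mem_insert] at hz ⊢
      tauto
    have hwn : w ∉ part c w (!b) := by simp [mem_part]
    have h2 : ((nb G v).card : ℝ) ≤ M + 1 := by
      have := Finset.card_le_card hsub
      rw [Finset.card_insert_of_notMem hwn] at this
      have h' : ((nb G v).card : ℝ) ≤ (part c w (!b)).card + 1 := by exact_mod_cast this
      linarith [hM (!b)]
    have h3 : ∑ z ∈ nb G v, x z ^ 2 ≤ 1 / 2 + x w ^ 2 := by
      have := Finset.sum_le_sum_of_subset_of_nonneg hsub (f := fun z => x z ^ 2)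
        fun i _ _ => sq_nonneg _
      rw [Finset.sum_insert hwn] at this
      have h' : al (!b) ≤ 1 / 2 := hhalf (!b)
      simp only [al] at h'
      linarith
    refine h1.trans (mul_le_mul h2 h3 (Finset.sum_nonneg fun i _ => sq_nonneg _) ?_)
    exact le_trans (Nat.cast_nonneg _) h2
  have hw1 : ρ ^ 2 * x w ^ 2 ≤ (nb G w).card * ∑ z ∈ nb G w, x z ^ 2 := by
    rw [← mul_pow, ← hx w]
    exact sq_sum_le_card_mul_sum_sq
  have hq1 : x w ^ 2 ≤ 1 := by
    have := htot true
    have := hal0 true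
    have := hal0 (!true)
    linarith
  refine ⟨x w ^ 2, sq_nonneg _, hq1, ?_, ?_, ?_⟩
  · have h1 := hbal true
    have h2 := hbal false
    have h3 := hsw true
    have h4 := htot true
    have h5 := hE true
    simp only [Bool.not_true] at h3 h4 h5
    have h6 : ρ * x w ^ 2 = x w * si true + x w * si false := by
      rw [pow_two, ← mul_assoc, h3]; ring
    have h7 : ρ * (1 - 2 * x w ^ 2) = 2 * E true := by
      have : ρ * (x w ^ 2 + (al true + al false)) = ρ := by rw [h4, mul_one]
      linarith
    have h8 : 1 - x w ^ 2 = al true + al false := by linarith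
    rw [← mul_pow, h7, h8]
    have h9 : (mid G c w true : ℝ) * (4 * (al true * al false))
        ≤ mid G c w true * (al true + al false) ^ 2 :=
      mul_le_mul_of_nonneg_left (by nlinarith [sq_nonneg (al true - al false)]) (Nat.cast_nonneg _)
    nlinarith
  · refine hw1.trans ?_
    have : ∑ z ∈ nb G w, x z ^ 2 ≤ 1 := by
      rw [← hx1]
      exact Finset.sum_le_sum_of_subset_of_nonneg (Finset.subset_univ _) fun i _ _ => sq_nonneg _
    exact mul_le_of_le_one_right (Nat.cast_nonneg _) this
  · have h1 : ρ ^ 2 * ∑ z ∈ nb G w, x z ^ 2 ≤ (nb G w).card * ((M + 1) * (1 / 2 + x w ^ 2)) := by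
      rw [Finset.mul_sum, ← nsmul_eq_mul, ← Finset.sum_const]
      apply Finset.sum_le_sum
      intro z hz
      refine hent (c z) z ?_
      rw [mem_part]
      exact ⟨((mem_nb G w z).1 hz).ne', rfl⟩
    have h2 := mul_le_mul_of_nonneg_left hw1 (sq_nonneg ρ)
    have h3 := mul_le_mul_of_nonneg_left h1 (show (0 : ℝ) ≤ (nb G w).card from Nat.cast_nonneg _)
    calc _ ≤ _ := h2
      _ = (nb G w).card * (ρ ^ 2 * ∑ z ∈ nb G w, x z ^ 2) := by ring
      _ ≤ _ := h3
      _ = _ := by ring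

lemma spec_arith {n r d L N R M q : ℝ} (hr : 1 ≤ r) (hn : 100000000 * (r + 1) ^ 2 ≤ n)
    (hd0 : 0 ≤ d) (hd : d ≤ 0.3 * n) (hL1 : 1 ≤ L) (hL : d - 2 * r ≤ L)
    (hN1 : n ^ 2 / 4 - n / 2 ≤ N) (hN2 : N ≤ n ^ 2 / 4) (hR : N ≤ R) (hM : M ≤ 0.55 * n)
    (hq0 : 0 ≤ q) (h1 : R * (1 - 2 * q) ^ 2 ≤ (N - L) * (1 - q) ^ 2)
    (h2 : R * q ≤ d) (h3 : R * (R * q) ≤ d ^ 2 * ((M + 1) * (1 / 2 + q))) : False := by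
  have hn1 : 400000000 ≤ n := by nlinarith
  have hn0 : 0 < n := by linarith
  have hnn : 400000000 * n ≤ n ^ 2 := by rw [pow_two]; exact mul_le_mul_of_nonneg_right hn1 hn0.le
  have hR1 : 0.249 * n ^ 2 ≤ R := by linarith
  have hq1 : q ≤ 0.001 := by
    by_contra! h
    have a1 : 0.249 * n ^ 2 * 0.001 ≤ R * q :=
      mul_le_mul hR1 h.le (by norm_num) (le_trans (by positivity) hR1)
    linarith
  have hb1 : (M + 1) * (1 / 2 + q) ≤ 0.276 * n := by
    calc (M + 1) * (1 / 2 + q) ≤ (0.55 * n + 1) * (1 / 2 + q) :=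
          mul_le_mul_of_nonneg_right (by linarith) (by linarith)
      _ ≤ (0.55 * n + 1) * 0.501 := mul_le_mul_of_nonneg_left (by linarith) (by positivity)
      _ ≤ _ := by linarith
  have hb2 : 0.249 * n ^ 2 * (0.249 * n ^ 2 * q) ≤ d ^ 2 * (0.276 * n) := by
    calc 0.249 * n ^ 2 * (0.249 * n ^ 2 * q) ≤ R * (R * q) :=
          mul_le_mul hR1 (mul_le_mul_of_nonneg_right hR1 hq0) (by positivity)
            (le_trans (by positivity) hR1)
      _ ≤ _ := h3
      _ ≤ _ := mul_le_mul_of_nonneg_left hb1 (sq_nonneg d)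
  have hb3 : q * n ^ 3 ≤ 4.46 * d ^ 2 := by
    have : (q * n ^ 3) * n ≤ (4.46 * d ^ 2) * n := by
      have p1 := mul_nonneg (sq_nonneg d) hn0.le
      have p2 : 0.249 * n ^ 2 * (0.249 * n ^ 2 * q) = 0.062001 * (q * n ^ 3 * n) := by ring
      rw [p2] at hb2
      linarith
    exact le_of_mul_le_mul_right this hn0
  have hb4 : L * (1 - q) ^ 2 ≤ 2 * N * q := by
    have a1 : N * (1 - 2 * q) ^ 2 ≤ R * (1 - 2 * q) ^ 2 :=
      mul_le_mul_of_nonneg_right hR (sq_nonneg _)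
    have hNp : 0 ≤ N := by linarith
    have a2 := mul_nonneg hNp (sq_nonneg q)
    have a3 : N * (1 - q) ^ 2 - N * (1 - 2 * q) ^ 2 = 2 * N * q - 3 * (N * q ^ 2) := by ring
    linarith
  have hb5 : 0.998 * L ≤ q * n ^ 2 / 2 := by
    have a1 : 0.998 * L ≤ (1 - q) ^ 2 * L := mul_le_mul_of_nonneg_right (by nlinarith) (by linarith)
    have a2 : N * q ≤ n ^ 2 / 4 * q := mul_le_mul_of_nonneg_right hN2 hq0
    linarith
  have hb6 : 0.998 * L * n ≤ 2.23 * d ^ 2 := by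
    have a1 := mul_le_mul_of_nonneg_right hb5 hn0.le
    have a2 : q * n ^ 2 / 2 * n = q * n ^ 3 / 2 := by ring
    linarith
  have hb7 : 0.998 * L ≤ 0.669 * d := by
    have : (0.998 * L) * n ≤ (0.669 * d) * n := by
      have a1 := mul_le_mul_of_nonneg_left hd hd0
      linarith
    exact le_of_mul_le_mul_right this hn0
  have hb8 : d ≤ 7 * r := by linarith
  have hb9 : d ^ 2 ≤ 49 * r ^ 2 := by
    have a1 := pow_le_pow_left₀ hd0 hb8 2
    rw [mul_pow] at a1
    linarith
  have hb10 : 1 * n ≤ L * n := mul_le_mul_of_nonneg_right hL1 hn0.le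
  have hb11 : (r + 1) ^ 2 = r ^ 2 + 2 * r + 1 := by ring
  linarith [sq_nonneg r]

lemma mid_eq {n r : ℕ} (hr : 1 ≤ r) {G : SimpleGraph (Fin n)} (hG : BookFree r G)
    (hnb : ¬ G.Colorable 2) (hn : 100000000 * (r + 1) ^ 2 ≤ n) {c : Fin n → Bool} {w : Fin n}
    (hp : ∀ u v, u ≠ w → v ≠ w → G.Adj u v → c u ≠ c v) (hρ : 0 < specRad G)
    (hd : ((nb G w).card : ℝ) ≤ 0.3 * n)
    (hN : ((((n - 1) / 2) * (n / 2) : ℕ) : ℝ) ≤ specRad G ^ 2)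
    (hN1 : (n : ℝ) ^ 2 / 4 - n / 2 ≤ (((n - 1) / 2) * (n / 2) : ℕ))
    (hN2 : ((((n - 1) / 2) * (n / 2) : ℕ) : ℝ) ≤ (n : ℝ) ^ 2 / 4)
    (hm : 0.249 * (n : ℝ) ^ 2 ≤ mid G c w true) :
    mid G c w true = ((n - 1) / 2) * (n / 2) := by
  set N := ((n - 1) / 2) * (n / 2) with hNd
  have h0 : mid G c w true ≤ N := (mid_le G c w true).trans (prod_le (part_card c w true))
  by_contra hne
  have hlt : mid G c w true + 1 ≤ N := by omega
  have hdeg := mid_add_deg_le hr hG hnb hp true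
  have hab := prod_le (part_card c w true)
  have hnpos : 0 < n := by nlinarith
  have hnR : 100000000 * ((r : ℝ) + 1) ^ 2 ≤ n := by exact_mod_cast hn
  have hM : ∀ b, ((part c w b).card : ℝ) ≤ 0.55 * n := by
    intro b
    have e1 : ((part c w b).card : ℝ) + (part c w (!b)).card + 1 = n := by
      exact_mod_cast part_card c w b
    have e2 : (mid G c w true : ℝ) ≤ (part c w b).card * (part c w (!b)).card := by
      have := mid_le G c w b
      have e : mid G c w b = mid G c w true := by
        cases b
        · exact mid_comm G c w false
        · rfl
      rw [e] at this
      exact_mod_cast this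
    by_contra! h
    have hn0 : (0 : ℝ) < n := by exact_mod_cast hnpos
    have e3 : ((part c w (!b)).card : ℝ) = n - 1 - (part c w b).card := by linarith
    rw [e3] at e2
    nlinarith
  obtain ⟨q, hq0, -, h1, h2, h3⟩ := spec_ineqs hnpos hp hρ _ hM
  have hltR : (mid G c w true : ℝ) + 1 ≤ N := by exact_mod_cast hlt
  have hdegR : (mid G c w true : ℝ) + (nb G w).card ≤ N + 2 * r := by
    have : mid G c w true + (nb G w).card ≤ N + 2 * r := by omega
    exact_mod_cast this
  refine spec_arith (n := n) (r := r) (d := (nb G w).card) (L := N - mid G c w true) (N := N)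
    (R := specRad G ^ 2) (M := 0.55 * n) (q := q) (by exact_mod_cast hr) hnR (by positivity) hd
    (by linarith) (by linarith) hN1 hN2 hN le_rfl hq0 ?_ h2 h3
  rw [sub_sub_cancel]
  exact h1

/-! ### A comparison graph -/

/-- Complete bipartite graph plus one vertex joined to one vertex on either side. -/
def exGraph (n : ℕ) : SimpleGraph (Fin n) :=
  SimpleGraph.fromRel (fun i j : Fin n => (i.1 < n / 2 ∧ n / 2 ≤ j.1 ∧ j.1 < n - 1) ∨
    (i.1 = n - 1 ∧ (j.1 = 0 ∨ j.1 = n / 2)))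

lemma exGraph_book {n r : ℕ} (hr : 1 ≤ r) (hn : 4 ≤ n) : BookFree r (exGraph n) := by
  intro u v huv
  refine le_trans ?_ hr
  rw [Set.ncard_le_one_iff]
  intro a b ha hb
  rw [Set.mem_ofPred_eq] at ha hb
  obtain ⟨ha1, ha2⟩ := ha
  obtain ⟨hb1, hb2⟩ := hb
  simp only [exGraph, SimpleGraph.fromRel_adj] at *
  apply Fin.ext
  have := u.2
  have := v.2
  have := a.2
  have := b.2
  rcases huv.2 with (h | h) | (h | h) <;> rcases ha1.2 with (h' | h') | (h' | h') <;>
    rcases ha2.2 with (h2 | h2) | (h2 | h2) <;> omega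

lemma exGraph_nb {n : ℕ} (hn : 4 ≤ n) : ¬ (exGraph n).Colorable 2 := by
  rintro ⟨f⟩
  have h1 : (exGraph n).Adj ⟨0, by omega⟩ ⟨n / 2, by omega⟩ := by
    simp only [exGraph, SimpleGraph.fromRel_adj, ne_eq, Fin.mk.injEq]
    omega
  have h2 : (exGraph n).Adj ⟨n - 1, by omega⟩ ⟨n / 2, by omega⟩ := by
    simp only [exGraph, SimpleGraph.fromRel_adj, ne_eq, Fin.mk.injEq]
    exact ⟨by omega, Or.inl (Or.inr ⟨trivial, Or.inr trivial⟩)⟩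
  have h3 : (exGraph n).Adj ⟨n - 1, by omega⟩ ⟨0, by omega⟩ := by
    simp only [exGraph, SimpleGraph.fromRel_adj, ne_eq, Fin.mk.injEq]
    exact ⟨by omega, Or.inl (Or.inr ⟨trivial, Or.inl trivial⟩)⟩
  have e1 := f.valid h1
  have e2 := f.valid h2
  have e3 := f.valid h3
  omega

lemma exGraph_spec {n : ℕ} (hn : 4 ≤ n) :
    0 < specRad (exGraph n) ∧ ((((n - 1) / 2) * (n / 2) : ℕ) : ℝ) ≤ specRad (exGraph n) ^ 2 := by
  classical
  obtain ⟨-, hR⟩ := spec_exists (by omega) (exGraph n)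
  set p := n / 2 with hp
  set q := (n - 1) / 2 with hq
  let SA : Finset (Fin n) := Finset.univ.filter (fun i => i.1 < p)
  let SB : Finset (Fin n) := Finset.univ.filter (fun i => p ≤ i.1 ∧ i.1 < n - 1)
  have hSA : SA.card = p := by
    rw [← Finset.card_map Fin.valEmbedding]
    have : SA.map Fin.valEmbedding = Finset.range p := by
      ext i
      simp only [SA, Finset.mem_map, Finset.mem_filter, Finset.mem_univ, true_and,
        Fin.valEmbedding_apply, Finset.mem_range]
      constructor
      · rintro ⟨a, ha, rfl⟩; exact ha
      · intro h; exact ⟨⟨i, by omega⟩, h, rfl⟩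
    rw [this, Finset.card_range]
  have hSB : SB.card = q := by
    rw [← Finset.card_map Fin.valEmbedding]
    have : SB.map Fin.valEmbedding = Finset.Ico p (n - 1) := by
      ext i
      simp only [SB, Finset.mem_map, Finset.mem_filter, Finset.mem_univ, true_and,
        Fin.valEmbedding_apply, Finset.mem_Ico]
      constructor
      · rintro ⟨a, ha, rfl⟩; exact ha
      · intro h; exact ⟨⟨i, by omega⟩, h, rfl⟩
    rw [this, Nat.card_Ico]; omega
  have hdisj : Disjoint SA SB := by
    rw [Finset.disjoint_left]
    intro i h1 h2
    simp [SA, SB] at h1 h2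
    omega
  let y : Fin n → ℝ := fun i => if i ∈ SA then Real.sqrt q else if i ∈ SB then Real.sqrt p else 0
  have hy0 : ∀ i, 0 ≤ y i := by
    intro i; simp only [y]; split_ifs <;> positivity
  have hyA : ∀ i ∈ SA, y i = Real.sqrt q := fun i hi => by simp only [y, hi, if_true]
  have hyB : ∀ i ∈ SB, y i = Real.sqrt p := fun i hi => by
    have : i ∉ SA := fun h => Finset.disjoint_left.1 hdisj h hi
    simp only [y, this, hi, if_true, if_false]
  have hyO : ∀ i ∉ SA ∪ SB, y i = 0 := fun i hi => by
    rw [Finset.mem_union, not_or] at hi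
    simp only [y, hi.1, hi.2, if_false]
  have hpp : Real.sqrt p ^ 2 = p := Real.sq_sqrt (by positivity)
  have hqq : Real.sqrt q ^ 2 = q := Real.sq_sqrt (by positivity)
  have hsq : ∑ i, y i ^ 2 = 2 * (p * q) := by
    rw [← Finset.sum_subset (Finset.subset_univ (SA ∪ SB))
      (fun i _ hi => by rw [hyO i hi]; simp), Finset.sum_union hdisj]
    have e1 : ∑ i ∈ SA, y i ^ 2 = ∑ i ∈ SA, (q : ℝ) :=
      Finset.sum_congr rfl (fun i hi => by rw [hyA i hi, hqq])
    have e2 : ∑ i ∈ SB, y i ^ 2 = ∑ i ∈ SB, (p : ℝ) :=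
      Finset.sum_congr rfl (fun i hi => by rw [hyB i hi, hpp])
    rw [e1, e2, Finset.sum_const, Finset.sum_const, hSA, hSB, nsmul_eq_mul, nsmul_eq_mul]
    ring
  have hAdj : ∀ i ∈ SA, ∀ j ∈ SB, (exGraph n).Adj i j := by
    intro i hi j hj
    simp only [SA, SB, Finset.mem_filter, Finset.mem_univ, true_and] at hi hj
    simp only [exGraph, SimpleGraph.fromRel_adj, ne_eq, Fin.ext_iff]
    omega
  have hlow : 2 * (p * q * (Real.sqrt p * Real.sqrt q))
      ≤ ∑ i, ∑ j ∈ nb (exGraph n) i, y i * y j := by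
    have h1 : ∑ i ∈ SA ∪ SB, ∑ j ∈ nb (exGraph n) i, y i * y j
        ≤ ∑ i, ∑ j ∈ nb (exGraph n) i, y i * y j :=
      Finset.sum_le_sum_of_subset_of_nonneg (Finset.subset_univ _)
        fun i _ _ => Finset.sum_nonneg fun j _ => mul_nonneg (hy0 i) (hy0 j)
    rw [Finset.sum_union hdisj] at h1
    have h2 : ∑ i ∈ SA, ∑ j ∈ SB, Real.sqrt p * Real.sqrt q
        ≤ ∑ i ∈ SA, ∑ j ∈ nb (exGraph n) i, y i * y j := by
      apply Finset.sum_le_sum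
      intro i hi
      calc _ = ∑ j ∈ SB, y i * y j := Finset.sum_congr rfl fun j hj => by
            rw [hyA i hi, hyB j hj, mul_comm]
        _ ≤ _ := Finset.sum_le_sum_of_subset_of_nonneg
            (fun j hj => (mem_nb _ i j).2 (hAdj i hi j hj))
            fun j _ _ => mul_nonneg (hy0 i) (hy0 j)
    have h3 : ∑ i ∈ SB, ∑ j ∈ SA, Real.sqrt p * Real.sqrt q
        ≤ ∑ i ∈ SB, ∑ j ∈ nb (exGraph n) i, y i * y j := by
      apply Finset.sum_le_sum
      intro i hi
      calc _ = ∑ j ∈ SA, y i * y j := Finset.sum_congr rfl fun j hj => by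
            rw [hyA j hj, hyB i hi]
        _ ≤ _ := Finset.sum_le_sum_of_subset_of_nonneg
            (fun j hj => (mem_nb _ i j).2 (hAdj j hj i hi).symm)
            fun j _ _ => mul_nonneg (hy0 i) (hy0 j)
    simp only [Finset.sum_const, hSA, hSB, nsmul_eq_mul] at h2 h3
    nlinarith
  have hRy := hR y
  rw [hsq] at hRy
  have hp1 : 1 ≤ p := by omega
  have hq1 : 1 ≤ q := by omega
  have hpR : (1 : ℝ) ≤ p := by exact_mod_cast hp1
  have hqR : (1 : ℝ) ≤ q := by exact_mod_cast hq1
  have hpq : (0 : ℝ) < p * q := by positivity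
  have hfin : Real.sqrt p * Real.sqrt q ≤ specRad (exGraph n) := by
    have : (2 * (p * q : ℝ)) * (Real.sqrt p * Real.sqrt q)
        ≤ (2 * (p * q : ℝ)) * specRad (exGraph n) := by linarith
    exact le_of_mul_le_mul_left this (by positivity)
  have hsp : 0 < Real.sqrt p * Real.sqrt q := by positivity
  refine ⟨lt_of_lt_of_le hsp hfin, ?_⟩
  have := pow_le_pow_left₀ hsp.le hfin 2
  rw [mul_pow, hpp, hqq] at this
  push_cast
  linarith

/-! ### The endgame -/

lemma numN (n : ℕ) (hn : 1 ≤ n) :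
    (n : ℝ) ^ 2 / 4 - n / 2 ≤ (((n - 1) / 2) * (n / 2) : ℕ) ∧
    ((((n - 1) / 2) * (n / 2) : ℕ) : ℝ) ≤ (n : ℝ) ^ 2 / 4 := by
  rcases Nat.even_or_odd' n with ⟨m, h | h⟩
  · obtain ⟨k, rfl⟩ : ∃ k, m = k + 1 := ⟨m - 1, by omega⟩
    have e1 : (n - 1) / 2 = k := by omega
    have e2 : n / 2 = k + 1 := by omega
    rw [e1, e2, h]
    push_cast
    have : (0 : ℝ) ≤ k := Nat.cast_nonneg _
    constructor <;> nlinarith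
  · have e1 : (n - 1) / 2 = m := by omega
    have e2 : n / 2 = m := by omega
    rw [e1, e2, h]
    push_cast
    have : (0 : ℝ) ≤ m := Nat.cast_nonneg _
    constructor <;> nlinarith

lemma bookfree_of {n r : ℕ} (hr : 1 ≤ r) {G : SimpleGraph (Fin n)} {c : Fin n → Bool} {w : Fin n}
    (hp : ∀ u v, u ≠ w → v ≠ w → G.Adj u v → c u ≠ c v)
    (h : ∀ b, (nb G w ∩ part c w b).card ≤ r) : BookFree r G := by
  have key : ∀ z, G.Adj w z → ({y | G.Adj w y ∧ G.Adj z y}).ncard ≤ r := by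
    intro z hz
    refine le_trans ?_ (h (!(c z)))
    rw [← Set.ncard_coe_finset]
    apply Set.ncard_le_ncard _ (Finset.finite_toSet _)
    rintro y ⟨h1, h2⟩
    have h3 := hp z y hz.ne' h1.ne' h2
    simp only [Finset.coe_inter, Set.mem_inter_iff, Finset.mem_coe, mem_nb, mem_part]
    refine ⟨h1, h1.ne', ?_⟩
    cases h4 : c y <;> cases h5 : c z <;> simp_all
  intro u z huz
  by_cases hu : u = w
  · subst hu
    exact key z huz
  by_cases hz : z = w
  · subst hz
    have := key u huz.symm
    simpa only [and_comm] using this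
  refine le_trans ?_ hr
  rw [← Set.ncard_singleton w]
  apply Set.ncard_le_ncard _ (Set.finite_singleton _)
  rintro y ⟨h1, h2⟩
  by_contra hy
  have hy : y ≠ w := hy
  have a1 := hp u y hu hy h1
  have a2 := hp z y hz hy h2
  have a3 := hp u z hu hz huz
  cases h4 : c y <;> cases h5 : c z <;> cases h6 : c u <;> simp_all

lemma complete_of_mid {n : ℕ} {G : SimpleGraph (Fin n)} {c : Fin n → Bool} {w : Fin n}
    (hm : mid G c w true = ((n - 1) / 2) * (n / 2)) (b : Bool) :
    (part c w b).card * (part c w (!b)).card = ((n - 1) / 2) * (n / 2) ∧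
    ∀ a ∈ part c w b, ∀ z ∈ part c w (!b), G.Adj a z := by
  have hb : mid G c w b = ((n - 1) / 2) * (n / 2) := by
    rw [← hm]
    cases b
    · exact mid_comm G c w false
    · rfl
  have h1 := mid_le G c w b
  have h2 := prod_le (part_card c w b)
  refine ⟨by omega, ?_⟩
  have h3 : ∑ v ∈ part c w b, (nb G v ∩ part c w (!b)).card
      = ∑ v ∈ part c w b, (part c w (!b)).card := by
    rw [Finset.sum_const, smul_eq_mul]
    change mid G c w b = _
    omega
  rw [Finset.sum_eq_sum_iff_of_le
    (fun v _ => Finset.card_le_card Finset.inter_subset_right)] at h3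
  intro a ha z hz
  have := Finset.eq_of_subset_of_card_le Finset.inter_subset_right (h3 a ha).ge
  rw [← this] at hz
  exact (mem_nb G a z).1 (Finset.mem_inter.1 hz).1

lemma pos_of_complete {n : ℕ} {G : SimpleGraph (Fin n)} {c : Fin n → Bool} {w : Fin n}
    (hnb : ¬ G.Colorable 2)
    (hp : ∀ u v, u ≠ w → v ≠ w → G.Adj u v → c u ≠ c v)
    (hk : ∀ b, ∀ a ∈ part c w b, ∀ z ∈ part c w (!b), G.Adj a z)
    (hρ : 0 < specRad G) {x : Fin n → ℝ} (hx : ∀ i, 0 ≤ x i) (hx1 : ∑ i, x i ^ 2 = 1)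
    (hxe : ∀ i, ∑ j ∈ nb G i, x j = specRad G * x i) : ∀ i, 0 < x i := by
  have hprop : ∀ i j, G.Adj i j → 0 < x j → 0 < x i := by
    intro i j hij hj
    have h1 : x j ≤ ∑ j ∈ nb G i, x j :=
      Finset.single_le_sum (fun k _ => hx k) ((mem_nb G i j).2 hij)
    rw [hxe i] at h1
    by_contra h
    have : x i = 0 := le_antisymm (not_lt.1 h) (hx i)
    rw [this] at h1
    linarith
  obtain ⟨p, hpp⟩ := nb_w_nonempty hnb hp true
  obtain ⟨q, hqq⟩ := nb_w_nonempty hnb hp false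
  rw [Finset.mem_inter, mem_nb] at hpp hqq
  have cases3 : ∀ i, i = w ∨ i ∈ part c w true ∨ i ∈ part c w false := by
    intro i
    simp only [mem_part]
    by_cases h : i = w
    · exact Or.inl h
    · cases h1 : c i <;> simp [h]
  have htw : ∀ i ∈ part c w true, 0 < x i → 0 < x w := fun i hi h =>
    hprop w q hqq.1 (hprop q i (hk true i hi q hqq.2).symm h)
  have hfw : ∀ i ∈ part c w false, 0 < x i → 0 < x w := fun i hi h =>
    hprop w p hpp.1 (hprop p i (hk true p hpp.2 i hi) h)
  have hw : 0 < x w := by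
    by_contra hw
    have : ∀ i, x i = 0 := by
      intro i
      by_contra hi
      have hi : 0 < x i := lt_of_le_of_ne (hx i) (Ne.symm hi)
      rcases cases3 i with h | h | h
      · exact hw (h ▸ hi)
      · exact hw (htw i h hi)
      · exact hw (hfw i h hi)
    simp [this] at hx1
  have hxp := hprop p w hpp.1.symm hw
  have hxq := hprop q w hqq.1.symm hw
  intro i
  rcases cases3 i with h | h | h
  · exact h ▸ hw
  · exact hprop i q (hk true i h q hqq.2) hxq
  · exact hprop i p (hk true p hpp.2 i h).symm hxp

lemma spec_lt {n : ℕ} (hn : 0 < n) {G G' : SimpleGraph (Fin n)} (hle : G ≤ G') {x : Fin n → ℝ}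
    (hx : ∀ i, 0 < x i) (hx1 : ∑ i, x i ^ 2 = 1)
    (hxe : ∀ i, ∑ j ∈ nb G i, x j = specRad G * x i) {w v : Fin n} (h1 : ¬ G.Adj w v)
    (h2 : G'.Adj w v) : specRad G < specRad G' := by
  have hR := (spec_exists hn G').2 x
  rw [hx1, mul_one] at hR
  refine lt_of_lt_of_le ?_ hR
  have e : ∑ i, ∑ j ∈ nb G i, x i * x j = specRad G := by
    have : ∀ i, ∑ j ∈ nb G i, x i * x j = specRad G * x i ^ 2 := by
      intro i
      rw [← Finset.mul_sum, hxe]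
      ring
    simp only [this]
    rw [← Finset.mul_sum, hx1, mul_one]
  rw [← e]
  have hsub : ∀ i, nb G i ⊆ nb G' i := fun i j hj =>
    (mem_nb G' i j).2 (hle ((mem_nb G i j).1 hj))
  apply Finset.sum_lt_sum
  · intro i _
    exact Finset.sum_le_sum_of_subset_of_nonneg (hsub i)
      fun j _ _ => (mul_pos (hx i) (hx j)).le
  · refine ⟨w, Finset.mem_univ _, ?_⟩
    exact Finset.sum_lt_sum_of_subset (hsub w) ((mem_nb G' w v).2 h2)
      (fun h => h1 ((mem_nb G w v).1 h)) (mul_pos (hx w) (hx v))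
      fun j _ _ => (mul_pos (hx w) (hx j)).le

lemma deg_w_eq {n r : ℕ} (hr : 1 ≤ r) {G : SimpleGraph (Fin n)} (hG : BookFree r G)
    (hnb : ¬ G.Colorable 2) (hn : 100000000 * (r + 1) ^ 2 ≤ n) {c : Fin n → Bool} {w : Fin n}
    (hp : ∀ u v, u ≠ w → v ≠ w → G.Adj u v → c u ≠ c v) (hρ : 0 < specRad G)
    (hm : mid G c w true = ((n - 1) / 2) * (n / 2))
    (hmax : ∀ H : SimpleGraph (Fin n), ¬ H.Colorable 2 → BookFree r H →
          specRad H ≤ specRad G) (b : Bool) : (nb G w ∩ part c w b).card = r := by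
  classical
  have hk := fun b => (complete_of_mid hm b).2
  have hnpos : 0 < n := by nlinarith
  have hup : ∀ b, (nb G w ∩ part c w b).card ≤ r := by
    intro b
    obtain ⟨y, hy⟩ := nb_w_nonempty hnb hp (!b)
    rw [Finset.mem_inter, mem_nb] at hy
    refine le_trans (Finset.card_le_card ?_) (book_nb hG hy.1)
    intro z hz
    rw [Finset.mem_inter, mem_nb] at hz
    rw [Finset.mem_inter, mem_nb, mem_nb]
    exact ⟨hz.1, (hk b z hz.2 y hy.2).symm⟩
  by_contra hne
  have hlt : (nb G w ∩ part c w b).card < r := lt_of_le_of_ne (hup b) hne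
  have hbig : r < (part c w b).card := by
    have h1 := (complete_of_mid hm b).1
    have h2 := part_card c w b
    have h3 := (numN n hnpos).1
    rw [← h1] at h3
    by_contra! h
    have a1 : (part c w b).card * (part c w (!b)).card ≤ r * n :=
      Nat.mul_le_mul h (by omega)
    have a2 : (((part c w b).card * (part c w (!b)).card : ℕ) : ℝ) ≤ r * n := by exact_mod_cast a1
    have a3 : 100000000 * ((r : ℝ) + 1) ^ 2 ≤ n := by exact_mod_cast hn
    have a4 : (0 : ℝ) ≤ r := Nat.cast_nonneg _
    have a5 : (0 : ℝ) < n := by exact_mod_cast hnpos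
    have a6 : 100 * ((r : ℝ) + 1) ≤ n := by nlinarith
    nlinarith
  obtain ⟨v, hvp, hvn⟩ : ∃ v ∈ part c w b, v ∉ nb G w := by
    by_contra! h
    have : part c w b ⊆ nb G w ∩ part c w b := fun v hv => Finset.mem_inter.2 ⟨h v hv, hv⟩
    have := Finset.card_le_card this
    omega
  rw [mem_nb] at hvn
  have hvp' := (mem_part c w b v).1 hvp
  let G' : SimpleGraph (Fin n) := G ⊔ SimpleGraph.edge w v
  have hadj : ∀ i j, G'.Adj i j ↔ G.Adj i j ∨ ((w = i ∧ v = j ∨ w = j ∧ v = i) ∧ i ≠ j) := by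
    intro i j
    simp only [G', SimpleGraph.sup_adj, SimpleGraph.edge_adj]
    tauto
  have hle : G ≤ G' := le_sup_left
  have hG'nb : ¬ G'.Colorable 2 := fun h => hnb (h.mono_left hle)
  have hp' : ∀ u v, u ≠ w → v ≠ w → G'.Adj u v → c u ≠ c v := by
    intro i j hi hj h
    rw [hadj] at h
    rcases h with h | ⟨h | h, -⟩
    · exact hp i j hi hj h
    · exact absurd h.1.symm hi
    · exact absurd h.1.symm hj
  have hwv : G'.Adj w v := (hadj w v).2 (Or.inr ⟨Or.inl ⟨rfl, rfl⟩, hvp'.1.symm⟩)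
  have hG' : BookFree r G' := by
    apply bookfree_of hr hp'
    intro b'
    by_cases hb : b' = b
    · subst hb
      have : nb G' w ∩ part c w b' ⊆ insert v (nb G w ∩ part c w b') := by
        intro z hz
        simp only [Finset.mem_inter, mem_nb, Finset.mem_insert, hadj] at hz ⊢
        rcases hz with ⟨h | ⟨h | h, h3⟩, h2⟩
        · exact Or.inr ⟨h, h2⟩
        · exact Or.inl h.2.symm
        · exact absurd h.1 h3
      have := (Finset.card_le_card this).trans (Finset.card_insert_le _ _)
      omega
    · have : nb G' w ∩ part c w b' ⊆ nb G w ∩ part c w b' := by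
        intro z hz
        simp only [Finset.mem_inter, mem_nb, hadj] at hz ⊢
        rcases hz with ⟨h | ⟨h | h, h3⟩, h2⟩
        · exact ⟨h, h2⟩
        · rw [← h.2, mem_part, hvp'.2] at h2
          exact absurd h2.2.symm hb
        · exact absurd h.1 h3
      exact (Finset.card_le_card this).trans (hup b')
  obtain ⟨x, hx, hx1, hxe⟩ := (spec_exists hnpos G).1
  have hxp := pos_of_complete hnb hp hk hρ hx hx1 hxe
  exact absurd (hmax G' hG'nb hG') (not_le.2 (spec_lt hnpos hle hxp hx1 hxe hvn hwv))

lemma lowV_mono {n r : ℕ} {G : SimpleGraph (Fin n)} (hG : BookFree r G) (hrn : r ≤ n) (hn : 0 < n)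
    (he : (n : ℝ) ^ 2 / 4 - (r + 1) * n ≤ G.edgeSet.ncard) :
    (lowV G 0.3).card ≤ 80000 * (r + 1) := by
  have h := lowV_card hG hrn hn he
  have : lowV G 0.3 ⊆ lowV G 0.495 := by
    intro v hv
    rw [mem_lowV] at hv ⊢
    have : (0 : ℝ) ≤ n := Nat.cast_nonneg _
    linarith
  have := Finset.card_le_card this
  omega

lemma max_edges {n r : ℕ} (hr : 1 ≤ r) {G : SimpleGraph (Fin n)} (hG : BookFree r G)
    (hnb : ¬ G.Colorable 2) (hn : 100000000 * (r + 1) ^ 2 ≤ n)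
    (hmax : ∀ H : SimpleGraph (Fin n), ¬ H.Colorable 2 → BookFree r H →
          specRad H ≤ specRad G) : G.edgeSet.ncard = ((n - 1) / 2) * (n / 2) + 2 * r := by
  have hn1 : 100000000 * (r + 1) ≤ n := by nlinarith
  have hn4 : 4 ≤ n := by omega
  have hnpos : 0 < n := by omega
  obtain ⟨hex0, hex⟩ := exGraph_spec hn4
  have hcmp := hmax _ (exGraph_nb hn4) (exGraph_book hr hn4)
  have hρ : 0 < specRad G := hex0.trans_le hcmp
  obtain ⟨hN1, hN2⟩ := numN n hnpos
  have hN : ((((n - 1) / 2) * (n / 2) : ℕ) : ℝ) ≤ specRad G ^ 2 :=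
    hex.trans (pow_le_pow_left₀ hex0.le hcmp 2)
  have hnR : 100000000 * ((r : ℝ) + 1) ^ 2 ≤ n := by exact_mod_cast hn
  have hn1R : 100000000 * ((r : ℝ) + 1) ≤ n := by exact_mod_cast hn1
  have hr0 : (0 : ℝ) ≤ r := Nat.cast_nonneg _
  have hn0 : (0 : ℝ) < n := by exact_mod_cast hnpos
  have hw := weak_edges hnpos hG
  have hrn : (0 : ℝ) ≤ r * n := mul_nonneg hr0 hn0.le
  have he : (n : ℝ) ^ 2 / 4 - (r + 1) * n ≤ G.edgeSet.ncard := by linarith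
  obtain ⟨c, hc⟩ := coloring_exists hG (by omega) he
  have hQ := lowV_mono hG (by omega) hnpos he
  have hs : 0.49 * (n : ℝ) ≤ specRad G := by
    by_contra! hlt
    have := pow_lt_pow_left₀ hlt hρ.le (n := 2) (by norm_num)
    nlinarith
  have hst := strong_edges hnpos hG c hc hs
  have hQR : ((lowV G 0.3).card : ℝ) ≤ 80000 * (r + 1) := by exact_mod_cast hQ
  have hst2 : (r : ℝ) * (lowV G 0.3).card ≤ 80000 * (r + 1) ^ 2 := by
    have := mul_le_mul_of_nonneg_left hQR hr0
    linarith
  have he2 : (n : ℝ) ^ 2 / 4 - n / 2 - 80000 * (r + 1) ^ 2 ≤ G.edgeSet.ncard := by linarith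
  obtain ⟨w, hd, hp⟩ := one_vertex hnb hn c hc hQ he2
  have hee := edges_eq hp true
  have heeR : (G.edgeSet.ncard : ℝ) = mid G c w true + (nb G w).card := by exact_mod_cast hee
  have hm : 0.249 * (n : ℝ) ^ 2 ≤ mid G c w true := by
    have : (10000 : ℝ) ≤ n := by linarith
    nlinarith
  have hmid := mid_eq hr hG hnb hn hp hρ hd hN hN1 hN2 hm
  have h1 := deg_w_eq hr hG hnb hn hp hρ hmid hmax true
  have h2 := deg_w_eq hr hG hnb hn hp hρ hmid hmax (!true)
  have h3 := nb_w_card G c w true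
  omega

lemma all_edges {n r : ℕ} (hr : 1 ≤ r) {G : SimpleGraph (Fin n)} (hG : BookFree r G)
    (hnb : ¬ G.Colorable 2) (hn : 100000000 * (r + 1) ^ 2 ≤ n) :
    G.edgeSet.ncard ≤ ((n - 1) / 2) * (n / 2) + 2 * r := by
  by_contra! hlt
  have hn1 : 100000000 * (r + 1) ≤ n := by nlinarith
  have hnpos : 0 < n := by omega
  obtain ⟨hN1, -⟩ := numN n hnpos
  have hltR : ((((n - 1) / 2) * (n / 2) : ℕ) : ℝ) ≤ G.edgeSet.ncard := by
    exact_mod_cast (by omega : ((n - 1) / 2) * (n / 2) ≤ G.edgeSet.ncard)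
  have hr0 : (0 : ℝ) ≤ r := Nat.cast_nonneg _
  have hn0 : (0 : ℝ) < n := by exact_mod_cast hnpos
  have hrn : (0 : ℝ) ≤ r * n := mul_nonneg hr0 hn0.le
  have he : (n : ℝ) ^ 2 / 4 - (r + 1) * n ≤ G.edgeSet.ncard := by linarith
  obtain ⟨c, hc⟩ := coloring_exists hG (by omega) he
  have hQ := lowV_mono hG (by omega) hnpos he
  have hsq := sq_nonneg ((r : ℝ) + 1)
  obtain ⟨w, -, hp⟩ := one_vertex hnb hn c hc hQ (by linarith)
  have := edges_le hr hG hnb hp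
  omega

/-- For every integer `r ≥ 1` and all sufficiently large `n`: every non-bipartite
`B_{r+1}`-free simple graph on `n` vertices whose adjacency matrix has maximum spectral radius
among all such graphs also has the maximum number of edges among all non-bipartite
`B_{r+1}`-free simple graphs on `n` vertices. -/
theorem stmt_6 (r : ℕ) (hr : 1 ≤ r) :
    ∃ n₀ : ℕ, ∀ n : ℕ, n₀ ≤ n →
      ∀ G : SimpleGraph (Fin n), ¬ G.Colorable 2 → BookFree r G →
        (∀ H : SimpleGraph (Fin n), ¬ H.Colorable 2 → BookFree r H →
          specRad H ≤ specRad G) →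
        (∀ H : SimpleGraph (Fin n), ¬ H.Colorable 2 → BookFree r H →
          H.edgeSet.ncard ≤ G.edgeSet.ncard) := by
  refine ⟨100000000 * (r + 1) ^ 2, fun n hn G hnb hG hmax H hHnb hH => ?_⟩
  rw [max_edges hr hG hnb hn hmax]
  exact all_edges hr hH hHnb hn
end
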